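/- Let r ≥ 2 be an integer, let α > 0 and δ ∈ (0,1) be reals, and let p = p(n) satisfy np → ∞ and p ≤ 1 − δ for all n. If d = d(n) is a sequence of nonnegative integers with d = o(√(np)), then with high probability (probability tending to 1 as n → ∞) the binomial random graph G_{n,p} admits a (d,r,α)-core. -/

import Mathlib

open scoped Classical
open Filter

noncomputable section

/-- The possible edges of a graph on vertex set `Fin n`. -/
abbrev EdgeType (n : ℕ) := {e : Sym2 (Fin n) // ¬ e.IsDiag}

/-- A graph on vertex set `Fin n`, identified with its edge set. -/
abbrev EdgeSetGraph (n : ℕ) := Finset (EdgeType n)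

/-- The size of the `r`-cut given by `φ` in `G`: the number of edges of `G` whose endpoints lie
in different parts. -/
def cutSize {n r : ℕ} (φ : Fin n → Fin r) (G : EdgeSetGraph n) : ℕ :=
  (G.filter fun e => ¬ (Sym2.map φ (e : Sym2 (Fin n))).IsDiag).card

/-- The maximum size of an `r`-cut of `G`. -/
def maxCut (n r : ℕ) (G : EdgeSetGraph n) : ℕ :=
  Finset.univ.sup fun φ : Fin n → Fin r => cutSize φ G

/-- The deficit of the `r`-cut `φ` in `G`. -/
def deficit {n : ℕ} (r : ℕ) (φ : Fin n → Fin r) (G : EdgeSetGraph n) : ℕ :=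
  maxCut n r G - cutSize φ G

/-- Probability of the event `A` under the binomial random graph `G_{n,p}`. -/
def prGnp (n : ℕ) (p : ℝ) (A : EdgeSetGraph n → Prop) : ℝ :=
  ∑ G ∈ Finset.univ.filter fun G : EdgeSetGraph n => A G,
    p ^ G.card * (1 - p) ^ (n.choose 2 - G.card)

/-- `G` admits a `(d,r,α)`-core: there are `r` pairwise-disjoint vertex sets, each of size
exceeding `(1/r - α) n`, contained in `r` different parts of every `r`-cut with deficit at
most `d`. -/
def AdmitsCore {n : ℕ} (d r : ℕ) (α : ℝ) (G : EdgeSetGraph n) : Prop :=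
  ∃ S : Fin r → Finset (Fin n),
    (∀ i j, i ≠ j → Disjoint (S i) (S j)) ∧
    (∀ i, ((1 : ℝ) / r - α) * n < ((S i).card : ℝ)) ∧
    ∀ φ : Fin n → Fin r, deficit r φ G ≤ d →
      ∃ σ : Fin r → Fin r, Function.Injective σ ∧ ∀ i, ∀ v ∈ S i, φ v = σ i

/-- The probability weight of `G` under `G_{n,p}`. -/
def wt (n : ℕ) (p : ℝ) (G : EdgeSetGraph n) : ℝ :=
  p ^ G.card * (1 - p) ^ (n.choose 2 - G.card)

/-- Expectation under `G_{n,p}`. -/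
def expect (n : ℕ) (p : ℝ) (f : EdgeSetGraph n → ℝ) : ℝ :=
  ∑ G, wt n p G * f G

lemma card_edgeType (n : ℕ) : Fintype.card (EdgeType n) = n.choose 2 := by
  have := Sym2.card_subtype_not_diag (α := Fin n)
  simpa using this

lemma wt_nonneg {n : ℕ} {p : ℝ} (h0 : 0 ≤ p) (h1 : p ≤ 1) (G : EdgeSetGraph n) :
    0 ≤ wt n p G := by
  unfold wt
  have : 0 ≤ 1 - p := by linarith
  positivity

lemma wt_mul_prod {n : ℕ} {p : ℝ} (a b : EdgeType n → ℝ) :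
    ∑ G : EdgeSetGraph n, wt n p G * ((∏ e ∈ G, a e) * ∏ e ∈ Finset.univ \ G, b e)
      = ∏ e : EdgeType n, (p * a e + (1 - p) * b e) := by
  rw [Finset.prod_add, Finset.powerset_univ]
  refine Finset.sum_congr rfl fun G _ => ?_
  rw [Finset.prod_mul_distrib, Finset.prod_mul_distrib, Finset.prod_const, Finset.prod_const,
    Finset.card_sdiff_of_subset (Finset.subset_univ G), Finset.card_univ, card_edgeType, wt]
  ring

lemma sum_wt (n : ℕ) (p : ℝ) : ∑ G : EdgeSetGraph n, wt n p G = 1 := by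
  have := wt_mul_prod (n := n) (p := p) (fun _ => 1) (fun _ => 1)
  simpa using this

section Expect

variable {n : ℕ} {p : ℝ}

lemma expect_const (c : ℝ) : expect n p (fun _ => c) = c := by
  unfold expect
  rw [← Finset.sum_mul, sum_wt, one_mul]

lemma expect_mono (h0 : 0 ≤ p) (h1 : p ≤ 1) {f g : EdgeSetGraph n → ℝ} (h : ∀ G, f G ≤ g G) :
    expect n p f ≤ expect n p g :=
  Finset.sum_le_sum fun G _ => mul_le_mul_of_nonneg_left (h G) (wt_nonneg h0 h1 G)

lemma expect_add (f g : EdgeSetGraph n → ℝ) :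
    expect n p (fun G => f G + g G) = expect n p f + expect n p g := by
  simp [expect, mul_add, Finset.sum_add_distrib]

lemma expect_sub (f g : EdgeSetGraph n → ℝ) :
    expect n p (fun G => f G - g G) = expect n p f - expect n p g := by
  simp [expect, mul_sub, Finset.sum_sub_distrib]

lemma expect_const_mul (c : ℝ) (f : EdgeSetGraph n → ℝ) :
    expect n p (fun G => c * f G) = c * expect n p f := by
  unfold expect
  rw [Finset.mul_sum]
  exact Finset.sum_congr rfl fun G _ => by ring

lemma expect_sum {ι : Type*} (s : Finset ι) (f : ι → EdgeSetGraph n → ℝ) :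
    expect n p (fun G => ∑ i ∈ s, f i G) = ∑ i ∈ s, expect n p (f i) := by
  unfold expect
  rw [Finset.sum_comm]
  exact Finset.sum_congr rfl fun G _ => by rw [Finset.mul_sum]

/-- Exponential moments of centred linear functions of the edge indicators. -/
lemma expect_exp_le (h0 : 0 ≤ p) (hp1 : p ≤ 1) (τ : ℝ) (hτ : τ ≤ 1) (t : EdgeType n → ℝ)
    (ht : ∀ e, |t e| ≤ τ) :
    expect n p (fun G => Real.exp (∑ e, t e * ((if e ∈ G then 1 else 0) - p)))
      ≤ Real.exp (n ^ 2 * p * τ ^ 2) := by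
  have h1 : expect n p (fun G => Real.exp (∑ e, t e * ((if e ∈ G then 1 else 0) - p)))
      = ∏ e : EdgeType n,
        (p * Real.exp (t e * (1 - p)) + (1 - p) * Real.exp (t e * (0 - p))) := by
    rw [← wt_mul_prod]
    refine Finset.sum_congr rfl fun G _ => ?_
    congr 1
    beta_reduce
    rw [Real.exp_sum, ← Finset.prod_sdiff (Finset.subset_univ G), mul_comm]
    congr 1
    · exact Finset.prod_congr rfl fun e he => by simp [he]
    · exact Finset.prod_congr rfl fun e he => by
        simp only [Finset.mem_sdiff] at he
        simp [he.2]
  have h2 : ∀ e : EdgeType n,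
      p * Real.exp (t e * (1 - p)) + (1 - p) * Real.exp (t e * (0 - p))
        ≤ Real.exp (p * τ ^ 2) := by
    intro e
    have hb := Real.abs_exp_sub_one_sub_id_le ((ht e).trans hτ)
    have hb' : Real.exp (t e) ≤ 1 + t e + τ ^ 2 := by
      have := (abs_le.1 hb).2
      have : t e ^ 2 ≤ τ ^ 2 := by
        rw [← sq_abs]; exact pow_le_pow_left₀ (abs_nonneg _) (ht e) 2
      linarith
    have e1 : Real.exp (t e * (1 - p)) = Real.exp (-(t e * p)) * Real.exp (t e) := by
      rw [← Real.exp_add]; ring_nf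
    have e2 : Real.exp (t e * (0 - p)) = Real.exp (-(t e * p)) := by ring_nf
    rw [e1, e2]
    have e3 : 1 + p * (Real.exp (t e) - 1) ≤ Real.exp (p * (t e + τ ^ 2)) := by
      have := Real.add_one_le_exp (p * (t e + τ ^ 2))
      nlinarith
    calc p * (Real.exp (-(t e * p)) * Real.exp (t e)) + (1 - p) * Real.exp (-(t e * p))
        = Real.exp (-(t e * p)) * (1 + p * (Real.exp (t e) - 1)) := by ring
      _ ≤ Real.exp (-(t e * p)) * Real.exp (p * (t e + τ ^ 2)) := by gcongr
      _ = Real.exp (p * τ ^ 2) := by rw [← Real.exp_add]; ring_nf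
  rw [h1]
  calc _ ≤ ∏ e : EdgeType n, Real.exp (p * τ ^ 2) := by
        refine Finset.prod_le_prod (fun e _ => ?_) fun e _ => h2 e
        have : 0 ≤ 1 - p := by linarith
        positivity
    _ = Real.exp ((n.choose 2 : ℕ) * (p * τ ^ 2)) := by
        rw [Finset.prod_const, Finset.card_univ, card_edgeType, ← Real.exp_nat_mul]
    _ ≤ _ := by
        apply Real.exp_le_exp.2
        have : ((n.choose 2 : ℕ) : ℝ) ≤ (n : ℝ) ^ 2 := by exact_mod_cast Nat.choose_le_pow n 2
        have h3 : 0 ≤ p * τ ^ 2 := by positivity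
        nlinarith

end Expect

/-- Adjacency in `G`. -/
def Adj {n : ℕ} (G : EdgeSetGraph n) (u v : Fin n) : Prop :=
  ∃ h : ¬ (s(u, v) : Sym2 (Fin n)).IsDiag, (⟨s(u, v), h⟩ : EdgeType n) ∈ G

/-- The graph `G` together with the edge `uv`. -/
def addEdge {n : ℕ} (u v : Fin n) (G : EdgeSetGraph n) : EdgeSetGraph n :=
  if h : ¬ (s(u, v) : Sym2 (Fin n)).IsDiag then insert ⟨s(u, v), h⟩ G else G

/-- The graph `G` without the edge `uv`. -/
def delEdge {n : ℕ} (u v : Fin n) (G : EdgeSetGraph n) : EdgeSetGraph n :=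
  if h : ¬ (s(u, v) : Sym2 (Fin n)).IsDiag then G.erase ⟨s(u, v), h⟩ else G

section Edges

variable {n r : ℕ} {p : ℝ} (G : EdgeSetGraph n) (u v : Fin n)

lemma adj_comm : Adj G u v ↔ Adj G v u := by
  unfold Adj
  rw [Sym2.eq_swap]

variable {G u v}

lemma adj_addEdge (h : u ≠ v) : Adj (addEdge u v G) u v := by
  have h' : ¬ (s(u, v) : Sym2 (Fin n)).IsDiag := by simpa using h
  refine ⟨h', ?_⟩
  simp [addEdge, h']

lemma not_adj_delEdge : ¬ Adj (delEdge u v G) u v := by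
  rintro ⟨h, h2⟩
  simp [delEdge, h] at h2

lemma addEdge_of_adj (h : Adj G u v) : addEdge u v G = G := by
  obtain ⟨h1, h2⟩ := h
  simp [addEdge, h1, h2]

lemma delEdge_of_not_adj (h : ¬ Adj G u v) : delEdge u v G = G := by
  by_cases h1 : (s(u, v) : Sym2 (Fin n)).IsDiag
  · simp only [delEdge, h1, not_true_eq_false, dite_false]
  · have h2 : (⟨s(u, v), h1⟩ : EdgeType n) ∉ G := fun h3 => h ⟨h1, h3⟩
    simp only [delEdge, h1, not_false_eq_true, dite_true]
    exact Finset.erase_eq_of_notMem h2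

lemma addEdge_addEdge : addEdge u v (addEdge u v G) = addEdge u v G := by
  unfold addEdge
  split_ifs <;> simp

lemma delEdge_addEdge : delEdge u v (addEdge u v G) = delEdge u v G := by
  by_cases h : (s(u, v) : Sym2 (Fin n)).IsDiag
  · simp only [addEdge, delEdge, h, not_true_eq_false, dite_false]
  · simp [addEdge, delEdge, h]

lemma addEdge_delEdge : addEdge u v (delEdge u v G) = addEdge u v G := by
  by_cases h : (s(u, v) : Sym2 (Fin n)).IsDiag
  · simp only [addEdge, delEdge, h, not_true_eq_false, dite_false]
  · simp only [addEdge, delEdge, h, not_false_eq_true, dite_true]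
    refine Finset.ext fun e => ?_
    simp only [Finset.mem_insert, Finset.mem_erase]
    tauto

/-- Each pair of vertices is adjacent independently of the rest of the graph. -/
lemma expect_adj (h : u ≠ v) (f : EdgeSetGraph n → ℝ) :
    (1 - p) * expect n p (fun G => if Adj G u v then f G else 0)
      = p * expect n p (fun G => if Adj G u v then 0 else f (addEdge u v G)) := by
  have h' : ¬ (s(u, v) : Sym2 (Fin n)).IsDiag := by simpa using h
  have key : ∑ G : EdgeSetGraph n with Adj G u v, (1 - p) * (wt n p G * f G)
      = ∑ G : EdgeSetGraph n with ¬ Adj G u v, p * (wt n p G * f (addEdge u v G)) := by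
    refine Finset.sum_bij' (fun G _ => delEdge u v G) (fun G _ => addEdge u v G) ?_ ?_ ?_ ?_ ?_
    · intro G _
      simp [not_adj_delEdge]
    · intro G _
      simp [adj_addEdge h]
    · intro G hG
      rw [addEdge_delEdge]
      exact addEdge_of_adj (by simpa using hG)
    · intro G hG
      rw [delEdge_addEdge]
      exact delEdge_of_not_adj (by simpa using hG)
    · intro G hG
      have hG : Adj G u v := by simpa using hG
      rw [addEdge_delEdge, addEdge_of_adj hG]
      obtain ⟨_, hm⟩ := hG
      have hc : (delEdge u v G).card + 1 = G.card := by
        simp only [delEdge, h', not_false_eq_true, dite_true]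
        exact Finset.card_erase_add_one hm
      have hle : G.card ≤ n.choose 2 := by
        rw [← card_edgeType]
        exact Finset.card_le_univ G
      unfold wt
      rw [← hc] at hle ⊢
      obtain ⟨k, hk⟩ := Nat.exists_eq_add_of_le hle
      rw [hk]
      have e1 : (delEdge u v G).card + 1 + k - ((delEdge u v G).card + 1) = k := by omega
      have e2 : (delEdge u v G).card + 1 + k - (delEdge u v G).card = k + 1 := by omega
      rw [e1, e2]
      ring
  unfold expect
  rw [Finset.mul_sum, Finset.mul_sum]
  rw [Finset.sum_filter, Finset.sum_filter] at key
  convert key using 2 with G _ G _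
  · by_cases hA : Adj G u v <;> simp [hA]
  · by_cases hA : Adj G u v <;> simp [hA]

lemma cutSize_eq (φ : Fin n → Fin r) (G : EdgeSetGraph n) :
    cutSize φ G
      = (Finset.filter (fun e : EdgeType n => ¬ (Sym2.map φ e.1).IsDiag) G).card := by
  unfold cutSize
  have h : (do let a ← G; pure ↑a : Finset (Sym2 (Fin n))) = G.image Subtype.val := by
    ext e
    simp [Finset.bind_def, Finset.pure_def]
  rw [h, Finset.filter_image, Finset.card_image_of_injective _ Subtype.val_injective]

lemma cutSize_addEdge (φ : Fin n → Fin r) (h : ¬ Adj G u v) :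
    cutSize φ (addEdge u v G) = cutSize φ G + if φ u = φ v then 0 else 1 := by
  by_cases h1 : (s(u, v) : Sym2 (Fin n)).IsDiag
  · have : u = v := by simpa using h1
    subst this
    simp [addEdge]
  · have h2 : (⟨s(u, v), h1⟩ : EdgeType n) ∉ G := fun h3 => h ⟨h1, h3⟩
    rw [cutSize_eq, cutSize_eq]
    simp only [addEdge, h1, not_false_eq_true, dite_true]
    rw [Finset.filter_insert]
    have h3 : (Sym2.map φ s(u, v)).IsDiag ↔ φ u = φ v := by simp
    by_cases h4 : φ u = φ v
    · rw [if_neg (not_not.2 (h3.2 h4)), if_pos h4, add_zero]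
    · rw [if_pos (mt h3.1 h4), if_neg h4, Finset.card_insert_of_notMem]
      exact fun h5 => h2 (Finset.mem_filter.1 h5).1

lemma two_mul_cutSize (φ : Fin n → Fin r) (G : EdgeSetGraph n) :
    2 * (cutSize φ G : ℝ) = ∑ u, ∑ v, if Adj G u v ∧ φ u ≠ φ v then 1 else 0 := by
  induction G using Finset.induction_on with
  | empty => simp [cutSize, Adj]
  | insert e G he ih =>
    obtain ⟨e, hd⟩ := e
    induction e using Sym2.ind with
    | _ a b =>
    have hab : a ≠ b := by simpa using hd
    have hna : ¬ Adj G a b := fun ⟨_, h⟩ => he h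
    have hna' : ¬ Adj G b a := fun h => hna ((adj_comm _ _ _).1 h)
    have hG : insert ⟨s(a, b), hd⟩ G = addEdge a b G := by
      simp only [addEdge, hd, not_false_eq_true, dite_true]
    rw [hG, cutSize_addEdge φ hna]
    have hadj : ∀ u v, Adj (addEdge a b G) u v ↔
        Adj G u v ∨ (u = a ∧ v = b) ∨ (u = b ∧ v = a) := by
      intro u v
      rw [← hG]
      constructor
      · rintro ⟨h1, h2⟩
        rw [Finset.mem_insert] at h2
        rcases h2 with h2 | h2
        · right
          simpa using h2
        · exact Or.inl ⟨h1, h2⟩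
      · rintro (⟨h1, h2⟩ | ⟨rfl, rfl⟩ | ⟨rfl, rfl⟩)
        · exact ⟨h1, Finset.mem_insert_of_mem h2⟩
        · exact ⟨hd, Finset.mem_insert_self _ _⟩
        · rw [adj_comm]
          exact ⟨hd, Finset.mem_insert_self _ _⟩
    have hterm : ∀ u v, (if Adj (addEdge a b G) u v ∧ φ u ≠ φ v then (1 : ℝ) else 0)
        = (if Adj G u v ∧ φ u ≠ φ v then 1 else 0)
          + (if u = a then if v = b then (if φ a = φ b then 0 else 1) else 0 else 0)
          + (if u = b then if v = a then (if φ a = φ b then 0 else 1) else 0 else 0) := by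
      intro u v
      simp only [hadj]
      by_cases h1 : u = a
      · subst h1
        by_cases h2 : v = b
        · subst h2
          simp [hna, hab]
        · simp [h2, hab]
      · by_cases h3 : u = b
        · subst h3
          by_cases h2 : v = a
          · subst h2
            simp [hna', hab.symm, eq_comm]
          · simp [h2, hab.symm]
        · simp [h1, h3]
    simp only [hterm, Finset.sum_add_distrib, ← ih]
    simp
    ring

end Edges

/-- Deviation of the number of (ordered) adjacent pairs between `X` and `Y` from its mean. -/
def dev {n : ℕ} (p : ℝ) (G : EdgeSetGraph n) (X Y : Finset (Fin n)) : ℝ :=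
  ∑ x ∈ X, ∑ y ∈ Y, if x = y then 0 else (if Adj G x y then 1 else 0) - p

/-- The largest deviation over all pairs of vertex sets. -/
def maxDev {n : ℕ} (p : ℝ) (G : EdgeSetGraph n) : ℝ :=
  (Finset.univ : Finset (Finset (Fin n) × Finset (Fin n))).sup' Finset.univ_nonempty
    fun XY => |dev p G XY.1 XY.2|

section Deviation

variable {n : ℕ} {p : ℝ}

lemma abs_dev_le_maxDev (G : EdgeSetGraph n) (X Y : Finset (Fin n)) :
    |dev p G X Y| ≤ maxDev p G :=
  Finset.le_sup' (fun XY : Finset (Fin n) × Finset (Fin n) => |dev p G XY.1 XY.2|)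
    (Finset.mem_univ (X, Y))

lemma maxDev_nonneg (G : EdgeSetGraph n) : 0 ≤ maxDev p G :=
  (abs_nonneg _).trans (abs_dev_le_maxDev G ∅ ∅)

/-- The number of ordered pairs in `X × Y` spanning the edge `e`. -/
def mult {n : ℕ} (X Y : Finset (Fin n)) (e : EdgeType n) : ℝ :=
  ∑ x ∈ X, ∑ y ∈ Y, if s(x, y) = (e : Sym2 (Fin n)) then 1 else 0

lemma mult_nonneg (X Y : Finset (Fin n)) (e : EdgeType n) : 0 ≤ mult X Y e :=
  Finset.sum_nonneg fun _ _ => Finset.sum_nonneg fun _ _ => by split_ifs <;> norm_num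

lemma mult_le (X Y : Finset (Fin n)) (e : EdgeType n) : mult X Y e ≤ 2 := by
  obtain ⟨e, hd⟩ := e
  induction e using Sym2.ind with
  | _ a b =>
  calc mult X Y ⟨s(a, b), hd⟩
      ≤ ∑ x : Fin n, ∑ y : Fin n, if s(x, y) = s(a, b) then 1 else 0 := by
        unfold mult
        refine (Finset.sum_le_sum fun x _ => Finset.sum_le_sum_of_subset_of_nonneg
          (Finset.subset_univ Y) fun _ _ _ => by split_ifs <;> norm_num).trans
          (Finset.sum_le_sum_of_subset_of_nonneg (Finset.subset_univ X) fun _ _ _ =>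
            Finset.sum_nonneg fun _ _ => by split_ifs <;> norm_num)
    _ ≤ ∑ x : Fin n, ∑ y : Fin n, ((if x = a then if y = b then 1 else 0 else 0)
          + (if x = b then if y = a then 1 else 0 else 0)) := by
        refine Finset.sum_le_sum fun x _ => Finset.sum_le_sum fun y _ => ?_
        by_cases h : s(x, y) = s(a, b)
        · rw [if_pos h]
          rcases Sym2.eq_iff.1 h with ⟨rfl, rfl⟩ | ⟨rfl, rfl⟩
          · simp only [if_true]
            have : (0 : ℝ) ≤ if x = y then if y = x then 1 else 0 else 0 := by
              split_ifs <;> norm_num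
            linarith
          · simp only [if_true]
            have : (0 : ℝ) ≤ if x = y then if y = x then 1 else 0 else 0 := by
              split_ifs <;> norm_num
            linarith
        · rw [if_neg h]
          refine add_nonneg ?_ ?_ <;> split_ifs <;> norm_num
    _ = 2 := by
        simp [Finset.sum_add_distrib]
        norm_num

lemma dev_eq (G : EdgeSetGraph n) (X Y : Finset (Fin n)) :
    dev p G X Y = ∑ e, mult X Y e * ((if e ∈ G then 1 else 0) - p) := by
  have h : ∀ x y : Fin n, (if x = y then 0 else (if Adj G x y then 1 else 0) - p)
      = ∑ e : EdgeType n, (if s(x, y) = (e : Sym2 (Fin n)) then 1 else 0)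
          * ((if e ∈ G then 1 else 0) - p) := by
    intro x y
    by_cases hxy : x = y
    · rw [if_pos hxy, eq_comm]
      refine Finset.sum_eq_zero fun e _ => ?_
      rw [if_neg, zero_mul]
      intro he
      exact e.2 (he ▸ by simpa using hxy)
    · have hd : ¬ (s(x, y) : Sym2 (Fin n)).IsDiag := by simpa using hxy
      rw [if_neg hxy, Finset.sum_eq_single (⟨s(x, y), hd⟩ : EdgeType n)]
      · simp [Adj, hxy]
      · intro e _ he
        rw [if_neg, zero_mul]
        intro h
        exact he (Subtype.ext h.symm)
      · simp
  unfold dev mult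
  simp only [h, Finset.sum_mul]
  rw [Finset.sum_comm (s := Finset.univ (α := EdgeType n))]
  refine Finset.sum_congr rfl fun x _ => ?_
  exact Finset.sum_comm

lemma expect_maxDev_le (h0 : 0 ≤ p) (hp1 : p ≤ 1) (hnp : 1 ≤ n * p) :
    expect n p (maxDev p) ≤ 10 * (n * √(n * p)) := by
  have hn : 1 ≤ n := by
    rcases Nat.eq_zero_or_pos n with rfl | h
    · norm_num at hnp
    · exact h
  set s := √(n * p) with hs
  have hs1 : 1 ≤ s := by rw [hs]; exact Real.one_le_sqrt.2 hnp
  have hss : s ^ 2 = n * p := Real.sq_sqrt (by linarith)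
  set θ : ℝ := 1 / (2 * s) with hθ
  have hθ0 : 0 < θ := by positivity
  have hτ : 2 * θ ≤ 1 := by
    rw [hθ]
    rw [mul_one_div, div_le_one (by positivity)]
    linarith
  have hτ2 : (n : ℝ) ^ 2 * p * (2 * θ) ^ 2 = n := by
    have : (2 * θ) ^ 2 * s ^ 2 = 1 := by
      rw [hθ]; field_simp
    have e : (n : ℝ) ^ 2 * p * (2 * θ) ^ 2 = n * ((2 * θ) ^ 2 * (n * p)) := by ring
    rw [e, ← hss, this, mul_one]
  have hexp : ∀ X Y : Finset (Fin n), ∀ σ : ℝ, |σ| = θ →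
      expect n p (fun G => Real.exp (σ * dev p G X Y)) ≤ Real.exp n := by
    intro X Y σ hσ
    have := expect_exp_le (n := n) h0 hp1 (2 * θ) hτ (fun e => σ * mult X Y e) (by
      intro e
      rw [abs_mul, hσ, abs_of_nonneg (mult_nonneg X Y e), mul_comm]
      gcongr
      exact mult_le X Y e)
    rw [hτ2] at this
    refine le_trans (le_of_eq ?_) this
    congr 1
    ext G
    rw [dev_eq, Finset.mul_sum]
    simp only [mul_assoc]
  set c : ℝ := n + n * Real.log 4 + Real.log 2 with hc
  have hsum : expect n p (fun G => Real.exp (θ * maxDev p G)) ≤ Real.exp c := by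
    calc expect n p (fun G => Real.exp (θ * maxDev p G))
        ≤ expect n p (fun G => ∑ XY : Finset (Fin n) × Finset (Fin n),
            (Real.exp (θ * dev p G XY.1 XY.2) + Real.exp (-θ * dev p G XY.1 XY.2))) := by
          refine expect_mono h0 hp1 fun G => ?_
          obtain ⟨XY, -, h⟩ := Finset.exists_mem_eq_sup' Finset.univ_nonempty
            (fun XY : Finset (Fin n) × Finset (Fin n) => |dev p G XY.1 XY.2|)
          rw [maxDev, h]
          refine le_trans ?_ (Finset.single_le_sum (f := fun XY : Finset (Fin n) × Finset (Fin n) =>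
            (Real.exp (θ * dev p G XY.1 XY.2) + Real.exp (-θ * dev p G XY.1 XY.2)))
            (fun _ _ => by positivity) (Finset.mem_univ XY))
          rcases abs_cases (dev p G XY.1 XY.2) with ⟨h, -⟩ | ⟨h, -⟩
          · rw [h]
            have := Real.exp_pos (-θ * dev p G XY.1 XY.2)
            linarith
          · rw [h]
            have := Real.exp_pos (θ * dev p G XY.1 XY.2)
            have e : θ * -dev p G XY.1 XY.2 = -θ * dev p G XY.1 XY.2 := by ring
            rw [e]
            linarith
      _ ≤ ∑ XY : Finset (Fin n) × Finset (Fin n), (Real.exp n + Real.exp n) := by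
          rw [expect_sum]
          refine Finset.sum_le_sum fun XY _ => ?_
          rw [expect_add]
          exact add_le_add (hexp _ _ _ (abs_of_pos hθ0))
            (hexp _ _ _ (by rw [abs_neg, abs_of_pos hθ0]))
      _ = Real.exp c := by
          rw [Finset.sum_const, Finset.card_univ, Fintype.card_prod, Fintype.card_finset,
            Fintype.card_fin, hc, Real.exp_add, Real.exp_add, Real.exp_log (by norm_num),
            mul_comm (n : ℝ) (Real.log 4), Real.exp_mul, Real.exp_log (by norm_num)]
          rw [nsmul_eq_mul, Real.rpow_natCast]
          have : ((2 ^ n * 2 ^ n : ℕ) : ℝ) = 4 ^ n := by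
            push_cast
            rw [← mul_pow]
            norm_num
          rw [this]
          ring
  have hlin : θ * expect n p (maxDev p) ≤ c := by
    have h : ∀ G : EdgeSetGraph n, θ * maxDev p G
        ≤ Real.exp (-c) * Real.exp (θ * maxDev p G) + (c - 1) := by
      intro G
      rw [← Real.exp_add]
      have := Real.add_one_le_exp (-c + θ * maxDev p G)
      linarith
    have h2 := expect_mono (n := n) h0 hp1 h
    rw [expect_const_mul, expect_add, expect_const_mul, expect_const] at h2
    have h3 : Real.exp (-c) * expect n p (fun G => Real.exp (θ * maxDev p G)) ≤ 1 := by
      calc _ ≤ Real.exp (-c) * Real.exp c := by gcongr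
        _ = 1 := by rw [← Real.exp_add]; simp
    linarith
  have hc5 : c ≤ 5 * n := by
    have h2 : Real.log 2 ≤ 1 := by linarith [Real.log_le_sub_one_of_pos (x := 2) (by norm_num)]
    have h4 : Real.log 4 ≤ 3 := by linarith [Real.log_le_sub_one_of_pos (x := 4) (by norm_num)]
    have hn' : (1 : ℝ) ≤ n := by exact_mod_cast hn
    rw [hc]
    nlinarith
  have : expect n p (maxDev p) = 2 * s * (θ * expect n p (maxDev p)) := by
    rw [hθ]; field_simp
  rw [this]
  nlinarith

end Deviation

/-- The maximum size in `G` of a cut from the family `F`. -/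
def familyCut {n r : ℕ} (F : Finset (Fin n → Fin r)) (G : EdgeSetGraph n) : ℕ :=
  F.sup fun φ => cutSize φ G

/-- The least deficit in `G` of a cut from the family `F`. -/
def gap {n r : ℕ} (F : Finset (Fin n → Fin r)) (G : EdgeSetGraph n) : ℕ :=
  maxCut n r G - familyCut F G

/-- Whether or not the pair `uv` is an edge does not affect the maximum cut. -/
def Nonpivotal {n : ℕ} (r : ℕ) (G : EdgeSetGraph n) (u v : Fin n) : Prop :=
  maxCut n r (addEdge u v G) = maxCut n r (delEdge u v G)

/-- The vertices forming a nonpivotal nonadjacent pair with `v`. -/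
def freeNbrs {n : ℕ} (r : ℕ) (G : EdgeSetGraph n) (v : Fin n) : Finset (Fin n) :=
  Finset.univ.filter fun w => w ≠ v ∧ ¬ Adj G v w ∧ Nonpivotal r G v w

/-- The non-neighbours of `v` in its own part of the cut `φ`. -/
def coNbrs {n r : ℕ} (φ : Fin n → Fin r) (G : EdgeSetGraph n) (v : Fin n) : Finset (Fin n) :=
  Finset.univ.filter fun w => w ≠ v ∧ ¬ Adj G v w ∧ φ w = φ v

/-- How far the degree of `v` in its own part falls below its expectation. -/
def shortfall {n r : ℕ} (p : ℝ) (φ : Fin n → Fin r) (G : EdgeSetGraph n) (v : Fin n) : ℝ :=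
  max 0 (∑ w, if w ≠ v ∧ φ w = φ v then p - (if Adj G v w then 1 else 0) else 0)

section Cuts

variable {n r : ℕ} {p : ℝ} {G : EdgeSetGraph n} {u v w : Fin n}
  {F : Finset (Fin n → Fin r)} {φ ψ : Fin n → Fin r}

lemma cutSize_le_familyCut (h : ψ ∈ F) : cutSize ψ G ≤ familyCut F G :=
  Finset.le_sup (f := fun φ => cutSize φ G) h

lemma exists_eq_familyCut (hF : F.Nonempty) (G : EdgeSetGraph n) :
    ∃ ψ ∈ F, cutSize ψ G = familyCut F G := by
  obtain ⟨ψ, h, e⟩ := Finset.exists_mem_eq_sup F hF fun φ => cutSize φ G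
  exact ⟨ψ, h, e.symm⟩

lemma cutSize_le_maxCut (ψ : Fin n → Fin r) (G : EdgeSetGraph n) :
    cutSize ψ G ≤ maxCut n r G :=
  cutSize_le_familyCut (Finset.mem_univ ψ)

lemma familyCut_le_maxCut : familyCut F G ≤ maxCut n r G :=
  Finset.sup_mono (Finset.subset_univ F)

lemma cutSize_le_addEdge (h : ¬ Adj G u v) : cutSize ψ G ≤ cutSize ψ (addEdge u v G) := by
  rw [cutSize_addEdge ψ h]
  exact Nat.le_add_right _ _

lemma familyCut_le_addEdge (h : ¬ Adj G u v) : familyCut F G ≤ familyCut F (addEdge u v G) :=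
  Finset.sup_mono_fun fun _ _ => cutSize_le_addEdge h

lemma maxCut_le_addEdge (h : ¬ Adj G u v) : maxCut n r G ≤ maxCut n r (addEdge u v G) :=
  familyCut_le_addEdge (F := Finset.univ) h

lemma maxCut_addEdge_of_nonpivotal (h : ¬ Adj G u v) (hz : Nonpivotal r G u v) :
    maxCut n r (addEdge u v G) = maxCut n r G := by
  rw [Nonpivotal, delEdge_of_not_adj h] at hz
  exact hz

lemma nonpivotal_addEdge : Nonpivotal r (addEdge u v G) u v ↔ Nonpivotal r G u v := by
  rw [Nonpivotal, Nonpivotal, addEdge_addEdge, delEdge_addEdge]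

/-- A nonadjacent pair separated by an optimal cut is pivotal. -/
lemma eq_of_nonpivotal (h : ¬ Adj G u v) (hz : Nonpivotal r G u v)
    (hφ : cutSize φ G = maxCut n r G) : φ u = φ v := by
  by_contra hne
  have h1 := cutSize_addEdge φ h
  rw [if_neg hne] at h1
  have h2 := cutSize_le_maxCut φ (addEdge u v G)
  rw [maxCut_addEdge_of_nonpivotal h hz] at h2
  omega

/-- An edge inside a part of an optimal cut is nonpivotal. -/
lemma nonpivotal_of_adj (h : Adj G u v) (hφ : cutSize φ G = maxCut n r G) (hs : φ u = φ v) :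
    Nonpivotal r G u v := by
  have h0 : ¬ Adj (delEdge u v G) u v := not_adj_delEdge
  have h1 := cutSize_addEdge φ h0
  rw [addEdge_delEdge, if_pos hs, addEdge_of_adj h] at h1
  have h2 := cutSize_le_maxCut φ (delEdge u v G)
  have h3 := maxCut_le_addEdge (r := r) h0
  rw [addEdge_delEdge, addEdge_of_adj h] at h3
  rw [Nonpivotal, addEdge_of_adj h]
  omega

lemma gap_addEdge_add_le (h : ¬ Adj G v w) (hz : Nonpivotal r G v w) (hψF : ψ ∈ F)
    (hψ : cutSize ψ G = familyCut F G) (D : ℕ) :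
    min (gap F (addEdge v w G)) D
      + (if 1 ≤ gap F G ∧ gap F G ≤ D ∧ ψ w ≠ ψ v then 1 else 0) ≤ min (gap F G) D := by
  have h1 := cutSize_addEdge ψ h
  have h2 : cutSize ψ (addEdge v w G) ≤ familyCut F (addEdge v w G) := cutSize_le_familyCut hψF
  have h3 := maxCut_addEdge_of_nonpivotal h hz
  have h4 : familyCut F (addEdge v w G) ≤ maxCut n r (addEdge v w G) := familyCut_le_maxCut
  unfold gap
  split_ifs with h5
  · obtain ⟨h5, h6, h7⟩ := h5
    rw [if_neg h7.symm] at h1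
    omega
  · have := familyCut_le_addEdge (F := F) h
    omega

lemma sum_shortfall_le (φ : Fin n → Fin r) :
    ∑ v, shortfall p φ G v ≤ r * maxDev p G := by
  have key : ∀ i : Fin r, ∑ v with φ v = i, shortfall p φ G v ≤ maxDev p G := by
    intro i
    obtain ⟨V, hV⟩ : ∃ V, V = Finset.univ.filter fun v => φ v = i := ⟨_, rfl⟩
    rw [← hV]
    set X := V.filter fun v =>
      0 ≤ ∑ w, if w ≠ v ∧ φ w = φ v then p - (if Adj G v w then 1 else 0) else 0 with hX
    have e : ∑ v ∈ V, shortfall p φ G v = - dev p G X V := by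
      rw [dev, hX, Finset.sum_filter, ← Finset.sum_neg_distrib]
      refine Finset.sum_congr rfl fun v hv => ?_
      have hv : φ v = i := by simpa [hV] using hv
      unfold shortfall
      split_ifs with h
      · rw [max_eq_right h, hV, Finset.sum_filter, ← Finset.sum_neg_distrib]
        refine Finset.sum_congr rfl fun w _ => ?_
        by_cases h1 : φ w = i
        · by_cases h2 : v = w
          · simp [h2]
          · simp [h1, h2, hv, Ne.symm h2]
        · simp [h1, hv]
      · rw [max_eq_left (not_le.1 h).le, neg_zero]
    rw [e]
    exact (neg_le_abs _).trans (abs_dev_le_maxDev G X V)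
  rw [← Finset.sum_fiberwise Finset.univ φ]
  calc _ ≤ ∑ _i : Fin r, maxDev p G := Finset.sum_le_sum fun i _ => key i
    _ = r * maxDev p G := by simp

lemma abs_sum_cross_le (φ : Fin n → Fin r) :
    |∑ u, ∑ v, (if φ u ≠ φ v then (if Adj G u v then 1 else 0) - p else 0)|
      ≤ r * maxDev p G := by
  have key : ∀ i : Fin r, |∑ u with φ u = i,
      ∑ v, (if φ u ≠ φ v then (if Adj G u v then 1 else 0) - p else 0)| ≤ maxDev p G := by
    intro i
    refine le_trans (le_of_eq (congrArg _ ?_)) (abs_dev_le_maxDev G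
      (Finset.univ.filter fun u => φ u = i) (Finset.univ.filter fun u => φ u ≠ i))
    rw [dev]
    refine Finset.sum_congr rfl fun u hu => ?_
    have hu : φ u = i := by simpa using hu
    rw [Finset.sum_filter]
    refine Finset.sum_congr rfl fun v _ => ?_
    by_cases h1 : φ v = i
    · simp [hu, h1]
    · have h2 : u ≠ v := by
        rintro rfl
        exact h1 hu
      simp [hu, h1, h2, Ne.symm h1]
  rw [← Finset.sum_fiberwise Finset.univ φ]
  refine (Finset.abs_sum_le_sum_abs _ _).trans ?_
  calc _ ≤ ∑ _i : Fin r, maxDev p G := Finset.sum_le_sum fun i _ => key i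
    _ = r * maxDev p G := by simp

end Cuts

section Estimates

variable {n r : ℕ} {p : ℝ} {F : Finset (Fin n → Fin r)} {Φ : EdgeSetGraph n → Fin n → Fin r}

/-- For a best cut `ψ` of a family with small positive gap, few vertices that are free with respect
to `v` are separated from `v` by `ψ`. -/
lemma expect_separated_le (h0 : 0 ≤ p) (h1 : p ≤ 1) {ψ : EdgeSetGraph n → Fin n → Fin r}
    (hψF : ∀ G, ψ G ∈ F) (hψ : ∀ G, cutSize (ψ G) G = familyCut F G)
    (hΦ : ∀ G, cutSize (Φ G) G = maxCut n r G) (v : Fin n) (D : ℕ) :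
    p * expect n p (fun G => ∑ w, if w ∈ freeNbrs r G v ∧ 1 ≤ gap F G ∧ gap F G ≤ D ∧
        ψ G w ≠ ψ G v then 1 else 0)
      ≤ D * expect n p (fun G => shortfall p (Φ G) G v) := by
  set h : EdgeSetGraph n → ℝ := fun G => (min (gap F G) D : ℕ) with hh
  have h_nonneg : ∀ G, 0 ≤ h G := fun G => Nat.cast_nonneg _
  have h_le : ∀ G, h G ≤ D := fun G => by
    simp only [hh]
    exact_mod_cast min_le_right _ _
  have key : ∀ w, p * expect n p (fun G => if w ∈ freeNbrs r G v ∧ 1 ≤ gap F G ∧ gap F G ≤ D ∧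
        ψ G w ≠ ψ G v then 1 else 0) ≤ expect n p (fun G => h G *
        (if w ≠ v ∧ Φ G w = Φ G v then p - (if Adj G v w then 1 else 0) else 0)) := by
    intro w
    by_cases hw : w = v
    · simp [hw, freeNbrs, expect]
    set f : EdgeSetGraph n → ℝ := fun G => if Nonpivotal r G v w then h G else 0 with hf
    have e1 : expect n p (fun G => if w ∈ freeNbrs r G v ∧ 1 ≤ gap F G ∧ gap F G ≤ D ∧
        ψ G w ≠ ψ G v then 1 else 0) ≤ expect n p (fun G => (if Adj G v w then 0 else f G)
          - (if Adj G v w then 0 else f (addEdge v w G))) := by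
      refine expect_mono h0 h1 fun G => ?_
      by_cases hA : Adj G v w
      · simp [freeNbrs, hA]
      by_cases hz : Nonpivotal r G v w
      · have hg := gap_addEdge_add_le hA hz (hψF G) (hψ G) D
        have hg' : h (addEdge v w G)
            + (if 1 ≤ gap F G ∧ gap F G ≤ D ∧ ψ G w ≠ ψ G v then 1 else 0) ≤ h G := by
          simp only [hh]
          exact_mod_cast hg
        have hz' := nonpivotal_addEdge.2 hz
        have hm : w ∈ freeNbrs r G v := by simp [freeNbrs, hA, hz, hw]
        simp only [hf, hA, hz, hz', hm, if_true, if_false, true_and]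
        linarith
      · have hz' := mt nonpivotal_addEdge.1 hz
        simp [freeNbrs, hf, hz, hz']
    have e2 := expect_adj (p := p) (Ne.symm hw) f
    have e3 : p * expect n p (fun G => (if Adj G v w then 0 else f G)
          - (if Adj G v w then 0 else f (addEdge v w G)))
        = expect n p (fun G => p * (if Adj G v w then 0 else f G)
          - (1 - p) * (if Adj G v w then f G else 0)) := by
      rw [expect_sub, expect_sub, expect_const_mul, expect_const_mul, e2]
      ring
    refine (mul_le_mul_of_nonneg_left e1 h0).trans (e3.trans_le ?_)
    refine expect_mono h0 h1 fun G => ?_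
    have := h_nonneg G
    have hph : 0 ≤ p * h G := mul_nonneg h0 this
    have hph' : 0 ≤ (1 - p) * h G := mul_nonneg (by linarith) this
    by_cases hA : Adj G v w
    · by_cases hs : Φ G w = Φ G v
      · have hz := nonpivotal_of_adj hA (hΦ G) hs.symm
        simp only [hf, hA, hz, hw, hs, if_true, ne_eq, not_false_eq_true, and_self]
        linarith
      · by_cases hz : Nonpivotal r G v w
        · simp only [hf, hA, hz, hs, if_true, and_false, if_false]
          linarith
        · simp [hf, hA, hz, hs]
    · by_cases hz : Nonpivotal r G v w
      · have hs := (eq_of_nonpivotal hA hz (hΦ G)).symm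
        simp only [hf, hA, hz, hw, hs, if_true, if_false, ne_eq, not_false_eq_true, and_self]
        linarith
      · by_cases hs : Φ G w = Φ G v
        · simp only [hf, hA, hz, hw, hs, if_true, if_false, ne_eq, not_false_eq_true, and_self]
          linarith
        · simp [hf, hz, hs]
  rw [expect_sum, Finset.mul_sum]
  refine (Finset.sum_le_sum fun w _ => key w).trans ?_
  rw [← expect_sum, ← expect_const_mul]
  refine expect_mono h0 h1 fun G => ?_
  rw [← Finset.mul_sum]
  have hs0 : 0 ≤ shortfall p (Φ G) G v := le_max_left _ _
  have hs1 : (∑ w, if w ≠ v ∧ Φ G w = Φ G v then p - (if Adj G v w then 1 else 0) else 0)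
      ≤ shortfall p (Φ G) G v := le_max_right _ _
  exact (mul_le_mul_of_nonneg_left hs1 (h_nonneg G)).trans
    (mul_le_mul_of_nonneg_right (h_le G) hs0)

/-- Few pivotal nonadjacent pairs lie inside a part of the optimal cut. -/
lemma expect_pivotal_le (h0 : 0 ≤ p) (h1 : p ≤ 1)
    (hΦ : ∀ G, cutSize (Φ G) G = maxCut n r G) :
    p * expect n p (fun G => ∑ v, (((coNbrs (Φ G) G v) \ (freeNbrs r G v)).card : ℝ))
      ≤ r * expect n p (maxDev p) := by
  have key : ∀ v w, p * expect n p (fun G =>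
        if w ∈ coNbrs (Φ G) G v \ freeNbrs r G v then 1 else 0)
      ≤ expect n p (fun G =>
        if Φ G v ≠ Φ G w then (if Adj G v w then 1 else 0) - p else 0) := by
    intro v w
    by_cases hw : w = v
    · simp [hw, coNbrs, expect]
    have e1 := expect_adj (p := p) (Ne.symm hw) fun G => if Nonpivotal r G v w then 0 else 1
    simp only [nonpivotal_addEdge] at e1
    have e2 : p * expect n p (fun G =>
          if w ∈ coNbrs (Φ G) G v \ freeNbrs r G v then 1 else 0)
        = p * expect n p (fun G => if Adj G v w then 0 else if Nonpivotal r G v w then 0 else 1)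
          - p * expect n p (fun G => if Adj G v w then 0 else if Φ G v ≠ Φ G w then 1 else 0) := by
      rw [← mul_sub, ← expect_sub]
      congr 2
      ext G
      by_cases hA : Adj G v w
      · simp [hA, coNbrs]
      by_cases hz : Nonpivotal r G v w
      · have hs := eq_of_nonpivotal hA hz (hΦ G)
        simp [hA, hz, hs, freeNbrs, hw]
      · by_cases hs : Φ G v = Φ G w
        · simp [hA, hz, hs, freeNbrs, coNbrs, hw]
        · simp [hA, hz, hs, freeNbrs, coNbrs, hw, Ne.symm hs]
    rw [e2, ← e1, ← expect_const_mul, ← expect_const_mul, ← expect_sub]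
    refine expect_mono h0 h1 fun G => ?_
    by_cases hA : Adj G v w
    · by_cases hs : Φ G v = Φ G w
      · have hz := nonpivotal_of_adj hA (hΦ G) hs
        simp [hA, hs, hz]
      · by_cases hz : Nonpivotal r G v w
        · simp [hA, hs, hz, h1]
        · simp [hA, hs, hz]
    · by_cases hs : Φ G v = Φ G w <;> simp [hA, hs]
  have hcard : ∀ G v, (((coNbrs (Φ G) G v) \ (freeNbrs r G v)).card : ℝ)
      = ∑ w, if w ∈ coNbrs (Φ G) G v \ freeNbrs r G v then 1 else 0 := by
    intro G v
    rw [Finset.sum_boole, Finset.filter_mem_eq_inter, Finset.univ_inter]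
  simp only [hcard]
  rw [expect_sum, Finset.mul_sum, ← expect_const_mul]
  refine le_trans ?_ (expect_mono h0 h1 fun G =>
    (le_abs_self _).trans (abs_sum_cross_le (G := G) (p := p) (Φ G)))
  rw [expect_sum]
  refine Finset.sum_le_sum fun v _ => ?_
  rw [expect_sum, expect_sum, Finset.mul_sum]
  exact Finset.sum_le_sum fun w _ => key v w

/-- The cuts separating `u` from `v`. -/
def separating {n : ℕ} (r : ℕ) (u v : Fin n) : Finset (Fin n → Fin r) :=
  Finset.univ.filter fun ψ => ψ u ≠ ψ v

lemma separating_nonempty (hr : 2 ≤ r) {u v : Fin n} (h : u ≠ v) :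
    (separating r u v).Nonempty := by
  refine ⟨fun w => if w = u then ⟨0, by omega⟩ else ⟨1, by omega⟩, ?_⟩
  simp [separating, h.symm]

lemma familyCut_separating_addEdge {G : EdgeSetGraph n} (hr : 2 ≤ r) {u v : Fin n}
    (h : u ≠ v) (hA : ¬ Adj G u v) :
    familyCut (separating r u v) (addEdge u v G) = familyCut (separating r u v) G + 1 := by
  have hs : ∀ ψ ∈ separating r u v, cutSize ψ (addEdge u v G) = cutSize ψ G + 1 := by
    intro ψ hψ
    have hψ : ψ u ≠ ψ v := by simpa [separating] using hψ
    rw [cutSize_addEdge ψ hA, if_neg hψ]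
  apply le_antisymm
  · refine Finset.sup_le fun ψ hψ => ?_
    rw [hs ψ hψ]
    exact Nat.succ_le_succ (cutSize_le_familyCut hψ)
  · obtain ⟨ψ, hψ, e⟩ := exists_eq_familyCut (separating_nonempty hr h) G
    rw [← e, ← hs ψ hψ]
    exact cutSize_le_familyCut hψ

/-- The pairs inside a part of the optimal cut that are separated by some cut of deficit at most
`d` are controlled through nonadjacent pairs. -/
lemma expect_separable_le (hr : 2 ≤ r) (h0 : 0 ≤ p) (h1 : p ≤ 1)
    (hΦ : ∀ G, cutSize (Φ G) G = maxCut n r G) {u v : Fin n} (huv : u ≠ v) (d : ℕ) :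
    (1 - p) * expect n p (fun G =>
        if Φ G u = Φ G v ∧ gap (separating r u v) G ≤ d then 1 else 0)
      ≤ expect n p (fun G => if v ∈ coNbrs (Φ G) G u \ freeNbrs r G u then 1 else 0)
        + expect n p (fun G => if ¬ Adj G u v ∧ 1 ≤ gap (separating r u v) G ∧
            gap (separating r u v) G ≤ d + 1 then 1 else 0) := by
  set b : EdgeSetGraph n → ℝ := fun G =>
    if Φ G u = Φ G v ∧ gap (separating r u v) G ≤ d then 1 else 0 with hb
  have e0 : (1 - p) * expect n p b = (1 - p) * expect n p (fun G => if Adj G u v then b G else 0)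
      + (1 - p) * expect n p (fun G => if Adj G u v then 0 else b G) := by
    rw [← mul_add, ← expect_add]
    congr 2
    ext G
    split_ifs <;> simp
  rw [e0, expect_adj huv, ← expect_const_mul, ← expect_const_mul, ← expect_add, ← expect_add]
  refine expect_mono h0 h1 fun G => ?_
  by_cases hA : Adj G u v
  · simp only [hA, if_true, not_true_eq_false, false_and, if_false]
    have : (0 : ℝ) ≤ if v ∈ coNbrs (Φ G) G u \ freeNbrs r G u then 1 else 0 := by
      split_ifs <;> norm_num
    linarith
  simp only [hA, if_false, not_false_eq_true, true_and]
  have c1 : b (addEdge u v G) ≤ if 1 ≤ gap (separating r u v) G ∧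
            gap (separating r u v) G ≤ d + 1 then 1 else 0 := by
    simp only [hb]
    by_cases hc : Φ (addEdge u v G) u = Φ (addEdge u v G) v ∧
        gap (separating r u v) (addEdge u v G) ≤ d
    · obtain ⟨hc1, hc2⟩ := hc
      have t1 := cutSize_addEdge (Φ (addEdge u v G)) hA
      rw [if_pos hc1, hΦ] at t1
      have t2 := cutSize_le_maxCut (Φ (addEdge u v G)) G
      have t3 := familyCut_separating_addEdge hr huv hA
      have t4 := maxCut_le_addEdge (r := r) hA
      have t5 : familyCut (separating r u v) (addEdge u v G) ≤ maxCut n r (addEdge u v G) :=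
        familyCut_le_maxCut
      unfold gap at hc2 ⊢
      rw [if_pos ⟨hc1, hc2⟩, if_pos ⟨by omega, by omega⟩]
    · rw [if_neg hc]
      split_ifs <;> norm_num
  have c2 : b G ≤ (if v ∈ coNbrs (Φ G) G u \ freeNbrs r G u then 1 else 0)
      + if 1 ≤ gap (separating r u v) G ∧ gap (separating r u v) G ≤ d + 1 then 1 else 0 := by
    simp only [hb]
    by_cases hc : Φ G u = Φ G v ∧ gap (separating r u v) G ≤ d
    · obtain ⟨hc1, hc2⟩ := hc
      rw [if_pos ⟨hc1, hc2⟩]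
      by_cases hg : 1 ≤ gap (separating r u v) G
      · have hc3 : 1 ≤ gap (separating r u v) G ∧ gap (separating r u v) G ≤ d + 1 :=
          ⟨hg, by omega⟩
        rw [if_pos hc3]
        split_ifs <;> norm_num
      · have hz : ¬ Nonpivotal r G u v := by
          intro hz
          obtain ⟨ψ, hψ, e⟩ := exists_eq_familyCut (separating_nonempty hr huv) G
          have hψ' : ψ u ≠ ψ v := by simpa [separating] using hψ
          refine hψ' (eq_of_nonpivotal hA hz ?_)
          have t1 : familyCut (separating r u v) G ≤ maxCut n r G := familyCut_le_maxCut
          unfold gap at hg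
          omega
        rw [if_pos (by simp [coNbrs, freeNbrs, hA, hz, hc1, huv.symm])]
        split_ifs <;> norm_num
    · rw [if_neg hc]
      refine add_nonneg ?_ ?_ <;> split_ifs <;> norm_num
  have c3 : b (addEdge u v G) ≤ 1 ∧ 0 ≤ b G := by
    simp only [hb]
    constructor <;> split_ifs <;> norm_num
  have c4 : (0 : ℝ) ≤ if v ∈ coNbrs (Φ G) G u \ freeNbrs r G u then 1 else 0 := by
    split_ifs <;> norm_num
  have c5 := mul_le_mul_of_nonneg_left c1 h0
  have c6 := mul_le_mul_of_nonneg_left c2 (sub_nonneg.2 h1)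
  nlinarith

end Estimates

section Counting

variable {n r : ℕ} {p δ : ℝ} {G : EdgeSetGraph n} {φ : Fin n → Fin r}

lemma le_sum_card_coNbrs_inter (hδ : 0 ≤ δ) (hp : p ≤ 1 - δ) (X Y : Finset (Fin n))
    (h : ∀ v ∈ X, ∀ w ∈ Y, φ w = φ v) :
    δ * (X.card * Y.card - X.card) - maxDev p G
      ≤ ∑ v ∈ X, ((coNbrs φ G v ∩ Y).card : ℝ) := by
  have e : ∑ v ∈ X, ((coNbrs φ G v ∩ Y).card : ℝ)
      = (∑ v ∈ X, ∑ w ∈ Y, if v = w then 0 else 1 - p) - dev p G X Y := by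
    rw [dev, ← Finset.sum_sub_distrib]
    refine Finset.sum_congr rfl fun v hv => ?_
    rw [← Finset.sum_sub_distrib, Finset.inter_comm, ← Finset.filter_mem_eq_inter,
      ← Finset.sum_boole]
    refine Finset.sum_congr rfl fun w hw => ?_
    by_cases hvw : v = w
    · simp [coNbrs, hvw]
    · by_cases hA : Adj G v w <;> simp [coNbrs, hvw, hA, h v hv w hw, Ne.symm hvw]
  have e2 : δ * (X.card * Y.card - X.card : ℝ)
      ≤ ∑ v ∈ X, ∑ w ∈ Y, if v = w then 0 else 1 - p := by
    have : ∀ v ∈ X, δ * (Y.card - 1 : ℝ) ≤ ∑ w ∈ Y, if v = w then 0 else 1 - p := by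
      intro v _
      have h1 : δ * (Y.card - 1 : ℝ) ≤ ∑ w ∈ Y, (δ - if v = w then δ else 0) := by
        rw [Finset.sum_sub_distrib, Finset.sum_const, nsmul_eq_mul, Finset.sum_ite_eq]
        split_ifs <;> linarith
      refine h1.trans (Finset.sum_le_sum fun w _ => ?_)
      split_ifs <;> linarith
    have := Finset.sum_le_sum this
    rw [Finset.sum_const, nsmul_eq_mul] at this
    linarith
  have := (le_abs_self _).trans (abs_dev_le_maxDev (p := p) G X Y)
  rw [e]
  linarith

/-- Few pairs inside a part of a cut have few common non-neighbours in this part. -/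
lemma sum_few_common_le (hδ : 0 < δ) (hδ1 : δ ≤ 1) (hp : p ≤ 1 - δ) {L : ℝ} (hL : 4 ≤ L) :
    (∑ u, ∑ v, if φ u = φ v ∧ ((coNbrs φ G v ∩ coNbrs φ G u).card : ℝ) < 2 * (δ * L / 8)
        then (1 : ℝ) else 0)
      ≤ n * (2 * maxDev p G / (δ * L)) + (r * maxDev p G + (L + 1) * n) / δ := by
  have hM := maxDev_nonneg (p := p) G
  set V : Fin r → Finset (Fin n) := fun i => Finset.univ.filter fun v => φ v = i with hV
  have hmem : ∀ u w, w ∈ coNbrs φ G u → φ w = φ u := by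
    intro u w hw
    simp only [coNbrs, Finset.mem_filter] at hw
    exact hw.2.2.2
  have hlarge : ∀ u, L ≤ (coNbrs φ G u).card →
      (∑ v, if φ u = φ v ∧ ((coNbrs φ G v ∩ coNbrs φ G u).card : ℝ) < 2 * (δ * L / 8)
        then (1 : ℝ) else 0) ≤ 2 * maxDev p G / (δ * L) := by
    intro u hu
    rw [Finset.sum_boole]
    set X := Finset.univ.filter fun v => φ u = φ v ∧
      ((coNbrs φ G v ∩ coNbrs φ G u).card : ℝ) < 2 * (δ * L / 8) with hX
    have h1 := le_sum_card_coNbrs_inter (G := G) hδ.le hp X (coNbrs φ G u) (φ := φ) (by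
      intro v hv w hw
      rw [hmem u w hw]
      exact (Finset.mem_filter.1 hv).2.1)
    have h2 : ∑ v ∈ X, ((coNbrs φ G v ∩ coNbrs φ G u).card : ℝ)
        ≤ ∑ v ∈ X, 2 * (δ * L / 8) :=
      Finset.sum_le_sum fun v hv => (Finset.mem_filter.1 hv).2.2.le
    rw [Finset.sum_const, nsmul_eq_mul] at h2
    rw [le_div_iff₀ (by positivity)]
    have hx : (0 : ℝ) ≤ X.card := Nat.cast_nonneg _
    have h3 : δ * (X.card * L) ≤ δ * (X.card * (coNbrs φ G u).card) := by gcongr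
    have h4 : δ * X.card * 4 ≤ δ * X.card * L := by gcongr
    nlinarith
  have hsmall : ∀ i, δ * ((((V i).filter fun u => ((coNbrs φ G u).card : ℝ) < L).card : ℝ)
      * (V i).card) ≤ maxDev p G + (L + 1) * (V i).card := by
    intro i
    set X := (V i).filter fun u => ((coNbrs φ G u).card : ℝ) < L with hX
    have hXV : (X.card : ℝ) ≤ (V i).card := by
      exact_mod_cast Finset.card_le_card (Finset.filter_subset _ _)
    have h1 := le_sum_card_coNbrs_inter (G := G) hδ.le hp X (V i) (φ := φ) (by
      intro v hv w hw
      have h1 := (Finset.mem_filter.1 (Finset.mem_filter.1 hv).1).2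
      have h2 := (Finset.mem_filter.1 hw).2
      rw [h1, h2])
    have h2 : ∑ v ∈ X, ((coNbrs φ G v ∩ V i).card : ℝ) ≤ ∑ v ∈ X, L :=
      Finset.sum_le_sum fun v hv => le_trans
        (by exact_mod_cast Finset.card_le_card Finset.inter_subset_left)
        (Finset.mem_filter.1 hv).2.le
    rw [Finset.sum_const, nsmul_eq_mul] at h2
    have hx : (0 : ℝ) ≤ X.card := Nat.cast_nonneg _
    have hn : L * X.card ≤ L * (V i).card := by gcongr
    have hn' : δ * X.card ≤ 1 * (V i).card := by gcongr
    linarith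
  have hu : ∀ u, (∑ v, if φ u = φ v ∧
      ((coNbrs φ G v ∩ coNbrs φ G u).card : ℝ) < 2 * (δ * L / 8) then (1 : ℝ) else 0)
      ≤ 2 * maxDev p G / (δ * L)
        + if ((coNbrs φ G u).card : ℝ) < L then ((V (φ u)).card : ℝ) else 0 := by
    intro u
    split_ifs with h
    · have h1 : (∑ v, if φ u = φ v ∧
          ((coNbrs φ G v ∩ coNbrs φ G u).card : ℝ) < 2 * (δ * L / 8) then (1 : ℝ) else 0)
          ≤ (V (φ u)).card := by
        rw [Finset.sum_boole]
        norm_cast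
        refine Finset.card_le_card fun v hv => ?_
        simp only [hV, Finset.mem_filter, Finset.mem_univ, true_and]
        exact (Finset.mem_filter.1 hv).2.1.symm
      have h2 : 0 ≤ 2 * maxDev p G / (δ * L) := by positivity
      linarith
    · rw [add_zero]
      exact hlarge u (not_lt.1 h)
  have hparts : ∑ u, (if ((coNbrs φ G u).card : ℝ) < L then ((V (φ u)).card : ℝ) else 0)
      ≤ (r * maxDev p G + (L + 1) * n) / δ := by
    have hcard : ∑ i, ((V i).card : ℝ) = n := by
      have := Finset.card_eq_sum_card_fiberwise (f := φ) (s := Finset.univ) (t := Finset.univ)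
        (fun _ _ => Finset.mem_coe.2 (Finset.mem_univ _))
      rw [Finset.card_univ, Fintype.card_fin] at this
      exact_mod_cast this.symm
    rw [← Finset.sum_fiberwise Finset.univ φ]
    calc _ ≤ ∑ i, (maxDev p G + (L + 1) * (V i).card) / δ := by
          refine Finset.sum_le_sum fun i _ => ?_
          rw [le_div_iff₀ hδ]
          refine le_trans (le_of_eq ?_) (hsmall i)
          rw [mul_comm δ]
          congr 1
          rw [Finset.card_filter, Nat.cast_sum, Finset.sum_mul]
          refine Finset.sum_congr rfl fun u hu => ?_
          have hu := (Finset.mem_filter.1 hu).2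
          rw [hu]
          split_ifs <;> simp
      _ = (r * maxDev p G + (L + 1) * n) / δ := by
          rw [← Finset.sum_div, Finset.sum_add_distrib, ← Finset.mul_sum, hcard]
          simp
  refine (Finset.sum_le_sum fun u _ => hu u).trans ?_
  rw [Finset.sum_add_distrib, Finset.sum_const, Finset.card_univ, Fintype.card_fin, nsmul_eq_mul]
  linarith

/-- A nonadjacent pair separated by a cut of small positive deficit has few common non-neighbours,
or many vertices that are free with respect to one of its ends are separated from that end, or
many pivotal pairs meet it. -/
lemma mul_le_of_separated {ψ : Fin n → Fin r} {u v : Fin n} {D : ℕ} {K : ℝ} (hK : 0 ≤ K)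
    (hψ : ψ ∈ separating r u v) (hφ : cutSize φ G = maxCut n r G) :
    K * (if ¬ Adj G u v ∧ 1 ≤ gap (separating r u v) G ∧ gap (separating r u v) G ≤ D
        then 1 else 0)
      ≤ (∑ w, if w ∈ freeNbrs r G u ∧ 1 ≤ gap (separating r u v) G ∧
            gap (separating r u v) G ≤ D ∧ ψ w ≠ ψ u then 1 else 0)
        + (∑ w, if w ∈ freeNbrs r G v ∧ 1 ≤ gap (separating r u v) G ∧
            gap (separating r u v) G ≤ D ∧ ψ w ≠ ψ v then 1 else 0)
        + (coNbrs φ G u \ freeNbrs r G u).card + (coNbrs φ G v \ freeNbrs r G v).card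
        + K * (if φ u = φ v ∧ ((coNbrs φ G v ∩ coNbrs φ G u).card : ℝ) < 2 * K
            then 1 else 0) := by
  have hψ' : ψ u ≠ ψ v := by simpa [separating] using hψ
  by_cases hW : ¬ Adj G u v ∧ 1 ≤ gap (separating r u v) G ∧ gap (separating r u v) G ≤ D
  swap
  · rw [if_neg hW, mul_zero]
    have h1 : (0 : ℝ) ≤ if φ u = φ v ∧
        ((coNbrs φ G v ∩ coNbrs φ G u).card : ℝ) < 2 * K then 1 else 0 := by
      split_ifs <;> norm_num
    have h2 : ∀ x, (0 : ℝ) ≤ ∑ w, if w ∈ freeNbrs r G x ∧ 1 ≤ gap (separating r u v) G ∧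
        gap (separating r u v) G ≤ D ∧ ψ w ≠ ψ x then 1 else 0 := fun x =>
      Finset.sum_nonneg fun w _ => by split_ifs <;> norm_num
    have := h2 u
    have := h2 v
    positivity
  rw [if_pos hW]
  obtain ⟨hA, hg1, hg2⟩ := hW
  have hs : φ u = φ v := by
    by_contra hne
    have h1 : cutSize φ G ≤ familyCut (separating r u v) G :=
      cutSize_le_familyCut (by simpa [separating] using hne)
    unfold gap at hg1
    omega
  simp only [hg1, hg2, true_and, Finset.sum_boole, hs]
  set S : Fin n → Finset (Fin n) := fun x =>
    Finset.univ.filter fun w => w ∈ freeNbrs r G x ∧ ψ w ≠ ψ x with hS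
  have hsub : coNbrs φ G v ∩ coNbrs φ G u
      ⊆ S u ∪ S v ∪ (coNbrs φ G u \ freeNbrs r G u) ∪ (coNbrs φ G v \ freeNbrs r G v) := by
    intro w hw
    obtain ⟨hwv, hwu⟩ := Finset.mem_inter.1 hw
    simp only [Finset.mem_union, Finset.mem_sdiff, hS, Finset.mem_filter, Finset.mem_univ,
      true_and]
    by_cases h1 : w ∈ freeNbrs r G u
    · by_cases h2 : w ∈ freeNbrs r G v
      · by_cases h3 : ψ w = ψ u
        · have h4 : ψ w ≠ ψ v := fun h => hψ' (h3.symm.trans h)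
          tauto
        · tauto
      · tauto
    · tauto
  have hcard : (coNbrs φ G v ∩ coNbrs φ G u).card ≤ (S u).card + (S v).card
      + (coNbrs φ G u \ freeNbrs r G u).card + (coNbrs φ G v \ freeNbrs r G v).card := by
    refine (Finset.card_le_card hsub).trans ?_
    refine (Finset.card_union_le _ _).trans (Nat.add_le_add_right ?_ _)
    refine (Finset.card_union_le _ _).trans (Nat.add_le_add_right ?_ _)
    exact Finset.card_union_le _ _
  have hcard' : ((coNbrs φ G v ∩ coNbrs φ G u).card : ℝ) ≤ (S u).card + (S v).card
      + (coNbrs φ G u \ freeNbrs r G u).card + (coNbrs φ G v \ freeNbrs r G v).card := by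
    exact_mod_cast hcard
  split_ifs with h
  · have h1 : (0 : ℝ) ≤ (S u).card := Nat.cast_nonneg _
    have h2 : (0 : ℝ) ≤ (S v).card := Nat.cast_nonneg _
    have h3 : (0 : ℝ) ≤ (coNbrs φ G u \ freeNbrs r G u).card := Nat.cast_nonneg _
    have h4 : (0 : ℝ) ≤ (coNbrs φ G v \ freeNbrs r G v).card := Nat.cast_nonneg _
    linarith
  · linarith

end Counting

section Combination

variable {n r : ℕ} {p δ : ℝ} {Φ : EdgeSetGraph n → Fin n → Fin r}

/-- The number of ordered pairs inside a part of `φ` separated by a cut of deficit at most `d`. -/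
def numSeparable {n r : ℕ} (d : ℕ) (φ : Fin n → Fin r) (G : EdgeSetGraph n) : ℝ :=
  ∑ u, ∑ v, if u ≠ v ∧ φ u = φ v ∧ gap (separating r u v) G ≤ d then 1 else 0

lemma expect_nonneg (h0 : 0 ≤ p) (h1 : p ≤ 1) {f : EdgeSetGraph n → ℝ} (h : ∀ G, 0 ≤ f G) :
    0 ≤ expect n p f :=
  Finset.sum_nonneg fun G _ => mul_nonneg (wt_nonneg h0 h1 G) (h G)

lemma expect_numSeparable_le (hr : 2 ≤ r) (h0 : 0 ≤ p) (hδ : 0 < δ) (hp : p ≤ 1 - δ)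
    (hΦ : ∀ G, cutSize (Φ G) G = maxCut n r G) (d : ℕ) {L : ℝ} (hL : 4 ≤ L) :
    p * (δ * L / 8) * δ * expect n p (fun G => numSeparable d (Φ G) G)
      ≤ (δ * L / 8) * (r * expect n p (maxDev p))
        + 2 * n * (d + 2) * (r * expect n p (maxDev p))
        + p * (δ * L / 8) * (n * (2 * expect n p (maxDev p) / (δ * L))
          + (r * expect n p (maxDev p) + (L + 1) * n) / δ) := by
  have h1 : p ≤ 1 := by linarith
  have hδ1 : δ ≤ 1 := by linarith
  obtain ⟨K, hK⟩ : ∃ K, K = δ * L / 8 := ⟨_, rfl⟩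
  have hK0 : 0 < K := by rw [hK]; positivity
  obtain ⟨M, hM⟩ : ∃ M, M = expect n p (maxDev p) := ⟨_, rfl⟩
  set m : Fin n → ℝ := fun v => expect n p fun G => shortfall p (Φ G) G v with hm
  set c : Fin n → ℝ := fun v =>
    expect n p fun G => ((coNbrs (Φ G) G v \ freeNbrs r G v).card : ℝ) with hc
  set P : Fin n → Fin n → ℝ := fun u v =>
    expect n p fun G => if v ∈ coNbrs (Φ G) G u \ freeNbrs r G u then 1 else 0 with hP
  set J : Fin n → Fin n → ℝ := fun u v => expect n p fun G =>
    if Φ G u = Φ G v ∧ ((coNbrs (Φ G) G v ∩ coNbrs (Φ G) G u).card : ℝ) < 2 * K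
      then 1 else 0 with hJ
  have hm_sum : ∑ v, m v ≤ r * M := by
    rw [hM, ← expect_const_mul, hm, ← expect_sum]
    exact expect_mono h0 h1 fun G => sum_shortfall_le (Φ G)
  have hc_sum : p * ∑ v, c v ≤ r * M := by
    rw [hM, hc, ← expect_sum]
    exact expect_pivotal_le h0 h1 hΦ
  have hP_sum : ∑ u, ∑ v, P u v = ∑ u, c u := by
    refine Finset.sum_congr rfl fun u _ => ?_
    rw [hP, ← expect_sum, hc]
    congr 1
    ext G
    rw [Finset.sum_boole, Finset.filter_mem_eq_inter, Finset.univ_inter]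
  have hJ_sum : ∑ u, ∑ v, J u v ≤ n * (2 * M / (δ * L)) + (r * M + (L + 1) * n) / δ := by
    have e1 : ∑ u, ∑ v, J u v = expect n p (fun G => ∑ u, ∑ v,
        if Φ G u = Φ G v ∧ ((coNbrs (Φ G) G v ∩ coNbrs (Φ G) G u).card : ℝ) < 2 * K
          then 1 else 0) := by
      rw [expect_sum]
      exact Finset.sum_congr rfl fun u _ => by rw [expect_sum]
    have e2 : n * (2 * M / (δ * L)) + (r * M + (L + 1) * n) / δ = expect n p (fun G =>
        (n * (2 / (δ * L)) + r / δ) * maxDev p G + (L + 1) * n / δ) := by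
      rw [expect_add, expect_const_mul, expect_const, ← hM]
      ring
    rw [e1, e2]
    refine expect_mono h0 h1 fun G => ?_
    rw [hK]
    refine (sum_few_common_le hδ hδ1 hp hL).trans (le_of_eq ?_)
    ring
  have key : ∀ u v, p * K * δ * expect n p (fun G =>
      if u ≠ v ∧ Φ G u = Φ G v ∧ gap (separating r u v) G ≤ d then 1 else 0)
      ≤ p * K * P u v + ((d + 1) * (m u + m v) + p * (c u + c v) + p * K * J u v) := by
    intro u v
    have hP0 : 0 ≤ P u v := expect_nonneg h0 h1 fun G => by split_ifs <;> norm_num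
    have hJ0 : 0 ≤ J u v := expect_nonneg h0 h1 fun G => by split_ifs <;> norm_num
    have hm0 : ∀ v, 0 ≤ m v := fun v => expect_nonneg h0 h1 fun G => le_max_left _ _
    have hc0 : ∀ v, 0 ≤ c v := fun v => expect_nonneg h0 h1 fun G => Nat.cast_nonneg _
    have := hm0 u
    have := hm0 v
    have := hc0 u
    have := hc0 v
    by_cases huv : u = v
    · have e : expect n p (fun G =>
          if u ≠ v ∧ Φ G u = Φ G v ∧ gap (separating r u v) G ≤ d then 1 else 0) = 0 := by
        simp [huv, expect]
      rw [e, mul_zero]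
      positivity
    choose ψ hψF hψ using fun G => exists_eq_familyCut (separating_nonempty hr huv) G
    have t1 := expect_separable_le hr h0 h1 hΦ huv d
    have t2 := expect_separated_le h0 h1 hψF hψ hΦ u (d + 1)
    have t3 := expect_separated_le h0 h1 hψF hψ hΦ v (d + 1)
    have t4 := expect_mono h0 h1 fun G =>
      mul_le_of_separated (G := G) (D := d + 1) hK0.le (hψF G) (hΦ G)
    simp only [expect_add, expect_const_mul] at t4
    simp only [ne_eq, huv, not_false_eq_true, true_and]
    push_cast at t2 t3
    set B := expect n p fun G => if Φ G u = Φ G v ∧ gap (separating r u v) G ≤ d then 1 else 0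
    set W := expect n p fun G => if ¬ Adj G u v ∧ 1 ≤ gap (separating r u v) G ∧
            gap (separating r u v) G ≤ d + 1 then 1 else 0
    have hB0 : 0 ≤ B := expect_nonneg h0 h1 fun G => by split_ifs <;> norm_num
    have t5 : δ * B ≤ P u v + W :=
      (mul_le_mul_of_nonneg_right (by linarith) hB0).trans t1
    have t6 := mul_le_mul_of_nonneg_left t5 (mul_nonneg h0 hK0.le)
    have t7 := mul_le_mul_of_nonneg_left t4 h0
    simp only [hP, hJ, hm, hc] at *
    linarith
  have total := Finset.sum_le_sum fun u (_ : u ∈ Finset.univ) =>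
    Finset.sum_le_sum fun v (_ : v ∈ Finset.univ) => key u v
  have e1 : p * K * δ * expect n p (fun G => numSeparable d (Φ G) G)
      = ∑ u, ∑ v, p * K * δ * expect n p (fun G =>
      if u ≠ v ∧ Φ G u = Φ G v ∧ gap (separating r u v) G ≤ d then 1 else 0) := by
    unfold numSeparable
    rw [expect_sum, Finset.mul_sum]
    refine Finset.sum_congr rfl fun u _ => ?_
    rw [expect_sum, Finset.mul_sum]
  have e2 : ∑ u, ∑ v, (p * K * P u v + ((d + 1) * (m u + m v) + p * (c u + c v) + p * K * J u v))
      = p * K * ∑ u, c u + 2 * n * (d + 1) * ∑ u, m u + 2 * n * p * ∑ u, c u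
        + p * K * ∑ u, ∑ v, J u v := by
    simp only [Finset.sum_add_distrib, ← Finset.mul_sum, hP_sum, Finset.sum_const,
      Finset.card_univ, Fintype.card_fin, nsmul_eq_mul]
    ring
  rw [← hK, ← hM, e1]
  refine total.trans ?_
  rw [e2]
  have hn : (0 : ℝ) ≤ n := Nat.cast_nonneg _
  have s1 := mul_le_mul_of_nonneg_left hc_sum hK0.le
  have s2 := mul_le_mul_of_nonneg_left hm_sum (by positivity : 0 ≤ 2 * n * ((d : ℝ) + 1))
  have s3 := mul_le_mul_of_nonneg_left hc_sum (by positivity : 0 ≤ 2 * (n : ℝ))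
  have s4 := mul_le_mul_of_nonneg_left hJ_sum (mul_nonneg h0 hK0.le)
  linarith

end Combination

section Core

variable {n r d : ℕ} {p : ℝ} {G : EdgeSetGraph n} {φ ψ : Fin n → Fin r}

lemma sum_card_parts (ψ : Fin n → Fin r) :
    ∑ i, ((Finset.univ.filter fun v => ψ v = i).card : ℝ) = n := by
  have := Finset.card_eq_sum_card_fiberwise (f := ψ) (s := Finset.univ) (t := Finset.univ)
    (fun _ _ => Finset.mem_coe.2 (Finset.mem_univ _))
  rw [Finset.card_univ, Fintype.card_fin] at this
  exact_mod_cast this.symm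

lemma sum_sum_ne (ψ : Fin n → Fin r) :
    (∑ u, ∑ v, if ψ u ≠ ψ v then (1 : ℝ) else 0)
      = n ^ 2 - ∑ i, ((Finset.univ.filter fun v => ψ v = i).card : ℝ) ^ 2 := by
  have h : ∀ u, (∑ v, if ψ u ≠ ψ v then (1 : ℝ) else 0)
      = n - ((Finset.univ.filter fun v => ψ v = ψ u).card : ℝ) := by
    intro u
    have : ∀ v, (if ψ u ≠ ψ v then (1 : ℝ) else 0) = 1 - if ψ v = ψ u then 1 else 0 := by
      intro v
      by_cases h : ψ u = ψ v
      · simp [h]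
      · simp [h, Ne.symm h]
    simp only [this, Finset.sum_sub_distrib, Finset.sum_boole]
    simp
  simp only [h, Finset.sum_sub_distrib]
  rw [← Finset.sum_fiberwise Finset.univ ψ fun u =>
    ((Finset.univ.filter fun v => ψ v = ψ u).card : ℝ)]
  congr 1
  · simp [sq]
  · refine Finset.sum_congr rfl fun i _ => ?_
    rw [Finset.sum_congr rfl (g := fun _ => ((Finset.univ.filter fun v => ψ v = i).card : ℝ)),
      Finset.sum_const, nsmul_eq_mul, sq]
    intro u hu
    rw [(Finset.mem_filter.1 hu).2]

lemma abs_two_mul_cutSize_sub_le (ψ : Fin n → Fin r) :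
    |2 * (cutSize ψ G : ℝ)
      - p * (n ^ 2 - ∑ i, ((Finset.univ.filter fun v => ψ v = i).card : ℝ) ^ 2)|
      ≤ r * maxDev p G := by
  refine le_trans (le_of_eq (congrArg _ ?_)) (abs_sum_cross_le (G := G) (p := p) ψ)
  rw [two_mul_cutSize, ← sum_sum_ne, Finset.mul_sum, ← Finset.sum_sub_distrib]
  refine Finset.sum_congr rfl fun u _ => ?_
  rw [Finset.mul_sum, ← Finset.sum_sub_distrib]
  refine Finset.sum_congr rfl fun v _ => ?_
  by_cases h : ψ u = ψ v <;> simp [h]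

lemma exists_balanced (hr : 0 < r) (n : ℕ) : ∃ β : Fin n → Fin r,
    ∀ i, ((Finset.univ.filter fun v => β v = i).card : ℝ) ≤ n / r + 1 := by
  refine ⟨fun v => ⟨v % r, Nat.mod_lt _ hr⟩, fun i => ?_⟩
  have h : (Finset.univ.filter fun v : Fin n =>
      (⟨v % r, Nat.mod_lt _ hr⟩ : Fin r) = i).card ≤ n / r + 1 := by
    rw [← Finset.card_range (n / r + 1)]
    refine Finset.card_le_card_of_injOn (fun v => v / r) ?_ ?_
    · intro v _
      rw [Finset.mem_coe, Finset.mem_range]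
      exact Nat.lt_succ_of_le (Nat.div_le_div_right v.2.le)
    · intro v hv w hw hvw
      have h1 : (v : ℕ) % r = i := congrArg Fin.val (Finset.mem_filter.1 hv).2
      have h2 : (w : ℕ) % r = i := congrArg Fin.val (Finset.mem_filter.1 hw).2
      have h3 : (v : ℕ) / r = w / r := hvw
      apply Fin.ext
      rw [← Nat.div_add_mod (v : ℕ) r, ← Nat.div_add_mod (w : ℕ) r, h1, h2, h3]
  calc _ ≤ ((n / r + 1 : ℕ) : ℝ) := by exact_mod_cast h
    _ ≤ _ := by
      push_cast
      gcongr
      exact Nat.cast_div_le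

/-- Cuts of small deficit are nearly balanced. -/
lemma abs_card_part_sub_le (hr : 0 < r) (h0 : 0 < p) {ε η : ℝ} (hε : 0 ≤ ε)
    (hη : (2 * r + 2) * η ≤ ε ^ 2 / 2) (hn : 2 ≤ ε ^ 2 * n)
    (hM : maxDev p G ≤ η * n ^ 2 * p) (hd : d ≤ η * n ^ 2 * p)
    (hψ : maxCut n r G ≤ cutSize ψ G + d) (i : Fin r) :
    |((Finset.univ.filter fun v => ψ v = i).card : ℝ) - n / r| ≤ ε * n := by
  obtain ⟨β, hβ⟩ := exists_balanced hr n
  set a : Fin r → ℝ := fun i => ((Finset.univ.filter fun v => ψ v = i).card : ℝ) with ha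
  set b : Fin r → ℝ := fun i => ((Finset.univ.filter fun v => β v = i).card : ℝ) with hb
  have hr' : (0 : ℝ) < r := by exact_mod_cast hr
  have hb2 : ∑ i, b i ^ 2 ≤ n ^ 2 / r + n := by
    calc ∑ i, b i ^ 2 ≤ ∑ i, b i * (n / r + 1) := by
          refine Finset.sum_le_sum fun i _ => ?_
          rw [sq]
          exact mul_le_mul_of_nonneg_left (hβ i) (Nat.cast_nonneg _)
      _ = n * (n / r + 1) := by rw [← Finset.sum_mul, hb, sum_card_parts]
      _ = n ^ 2 / r + n := by ring
  have h1 := (abs_le.1 (abs_two_mul_cutSize_sub_le (G := G) (p := p) ψ)).2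
  have h2 := (abs_le.1 (abs_two_mul_cutSize_sub_le (G := G) (p := p) β)).1
  have h3 : (cutSize β G : ℝ) ≤ cutSize ψ G + d := by
    exact_mod_cast (cutSize_le_maxCut β G).trans hψ
  have h4 : p * ∑ i, a i ^ 2 ≤ p * (n ^ 2 / r + n + (2 * r + 2) * η * n ^ 2) := by
    have h5 := mul_le_mul_of_nonneg_left hb2 h0.le
    have h6 := mul_le_mul_of_nonneg_left hM hr'.le
    linarith
  have h5 := le_of_mul_le_mul_left h4 h0
  have h6 : ∑ i, (a i - n / r) ^ 2 = ∑ i, a i ^ 2 - n ^ 2 / r := by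
    have : ∀ i, (a i - n / r) ^ 2 = a i ^ 2 - 2 * (n / r) * a i + (n / r) ^ 2 := by
      intro i
      ring
    simp only [this, Finset.sum_add_distrib, Finset.sum_sub_distrib, ← Finset.mul_sum]
    rw [ha, sum_card_parts]
    simp only [Finset.sum_const, Finset.card_univ, Fintype.card_fin, nsmul_eq_mul]
    field_simp
    ring
  have h7 := Finset.single_le_sum (f := fun i => (a i - n / r) ^ 2) (fun i _ => sq_nonneg _)
    (Finset.mem_univ i)
  have hn0 : (0 : ℝ) ≤ n := Nat.cast_nonneg _
  have h8 : (n : ℝ) ≤ ε ^ 2 / 2 * n ^ 2 := by nlinarith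
  have h9 : (2 * r + 2) * η * n ^ 2 ≤ ε ^ 2 / 2 * (n : ℝ) ^ 2 := by gcongr
  refine abs_le_of_sq_le_sq ?_ (by positivity)
  beta_reduce at h7
  rw [mul_pow]
  linarith

lemma gap_separating_le {u v : Fin n} (hψ : maxCut n r G ≤ cutSize ψ G + d)
    (h : ψ u ≠ ψ v) : gap (separating r u v) G ≤ d := by
  have : cutSize ψ G ≤ familyCut (separating r u v) G :=
    cutSize_le_familyCut (by simpa [separating] using h)
  unfold gap
  omega

/-- If few pairs inside the parts of an optimal cut can be separated and cuts of small deficit are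
nearly balanced, then there is a core. -/
lemma admitsCore_of_balanced {α ε η : ℝ} (hr : 2 ≤ r) (hn : 0 < n) (hα : 4 * r * α ≤ 1)
    (hα0 : 0 < α) (hε : 4 * ε ≤ α) (hη : 8 * r * η ≤ α)
    (hφ : cutSize φ G = maxCut n r G) (hB : numSeparable d φ G ≤ η * n ^ 2)
    (hbal : ∀ ψ : Fin n → Fin r, maxCut n r G ≤ cutSize ψ G + d → ∀ i,
      |((Finset.univ.filter fun v => ψ v = i).card : ℝ) - n / r| ≤ ε * n) :
    AdmitsCore d r α G := by
  have hr' : (2 : ℝ) ≤ r := by exact_mod_cast hr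
  have hn' : (0 : ℝ) < n := by exact_mod_cast hn
  have hαr : α ≤ 1 / (4 * r) := by
    rw [le_div_iff₀ (by positivity)]
    linarith
  have hαr' : 4 * α ≤ 1 / r := by
    rw [le_div_iff₀ (by positivity)]
    linarith
  set V : Fin r → Finset (Fin n) := fun i => Finset.univ.filter fun v => φ v = i with hV
  set T : Fin n → Finset (Fin n) := fun u => Finset.univ.filter fun v =>
    u ≠ v ∧ φ u = φ v ∧ gap (separating r u v) G ≤ d with hT
  have hVcard : ∀ i, (1 / r - α / 4) * n ≤ ((V i).card : ℝ) := by
    intro i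
    have h1 := (abs_le.1 (hbal φ (by omega) i)).1
    have h2 : ε * n ≤ α / 4 * n := by gcongr; linarith
    have h3 : (n : ℝ) / r = 1 / r * n := by ring
    simp only [hV]
    linarith
  have hu : ∀ i, ∃ u ∈ V i, ((T u).card : ℝ) ≤ α / 4 * n := by
    intro i
    by_contra hcon
    push Not at hcon
    have h1 : ∑ u ∈ V i, α / 4 * n ≤ ∑ u ∈ V i, ((T u).card : ℝ) :=
      Finset.sum_le_sum fun u hu => (hcon u hu).le
    have h2 : ∑ u ∈ V i, ((T u).card : ℝ) ≤ numSeparable d φ G := by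
      rw [numSeparable]
      simp only [Finset.sum_boole]
      exact Finset.sum_le_sum_of_subset_of_nonneg (Finset.subset_univ _)
        fun _ _ _ => Nat.cast_nonneg _
    rw [Finset.sum_const, nsmul_eq_mul] at h1
    have h3 := mul_le_mul_of_nonneg_right (hVcard i) (by positivity : 0 ≤ α / 4 * n)
    have h4 : 1 / r / 2 * α / 4 * n ^ 2 < (1 / r - α / 4) * n * (α / 4 * n) := by
      have : 0 < (1 / r / 2 - α / 4) * (α / 4) * n ^ 2 := by
        have : 0 < 1 / r / 2 - α / 4 := by linarith
        positivity
      nlinarith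
    have h5 : η ≤ 1 / r / 2 * α / 4 := by
      rw [show 1 / (r : ℝ) / 2 * α / 4 = α / (8 * r) by field_simp; norm_num,
        le_div_iff₀ (by positivity)]
      linarith
    have h6 : η * n ^ 2 ≤ 1 / r / 2 * α / 4 * (n : ℝ) ^ 2 := by gcongr
    linarith
  choose u huV huT using hu
  have hSmem : ∀ i, ∀ v ∈ V i \ T (u i), ∀ ψ : Fin n → Fin r,
      maxCut n r G ≤ cutSize ψ G + d → ψ v = ψ (u i) := by
    intro i v hv ψ hψ
    by_contra hne
    obtain ⟨hv1, hv2⟩ := Finset.mem_sdiff.1 hv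
    apply hv2
    have e1 : φ v = i := (Finset.mem_filter.1 hv1).2
    have e2 : φ (u i) = i := (Finset.mem_filter.1 (huV i)).2
    simp only [hT, Finset.mem_filter, Finset.mem_univ, true_and]
    refine ⟨?_, e2.trans e1.symm, gap_separating_le hψ (Ne.symm hne)⟩
    rintro h
    exact hne (by rw [h])
  have hScard : ∀ i, (1 / r - α / 2) * n ≤ ((V i \ T (u i)).card : ℝ) := by
    intro i
    have h1 : ((V i).card : ℝ) ≤ (V i \ T (u i)).card + (T (u i)).card := by
      exact_mod_cast Finset.card_le_card_sdiff_add_card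
    have h2 := huT i
    have h3 := hVcard i
    linarith
  have hdisj : ∀ i j, i ≠ j → Disjoint (V i \ T (u i)) (V j \ T (u j)) := by
    intro i j hij
    rw [Finset.disjoint_left]
    intro v hi hj
    have e1 : φ v = i := (Finset.mem_filter.1 (Finset.mem_sdiff.1 hi).1).2
    have e2 : φ v = j := (Finset.mem_filter.1 (Finset.mem_sdiff.1 hj).1).2
    exact hij (e1.symm.trans e2)
  refine ⟨fun i => V i \ T (u i), hdisj, fun i => ?_, fun ψ hψ => ?_⟩
  · have := hScard i
    have : 0 < α / 2 * n := by positivity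
    linarith
  · have hψ' : maxCut n r G ≤ cutSize ψ G + d := by
      unfold deficit at hψ
      omega
    refine ⟨fun i => ψ (u i), fun i j hij => ?_, fun i v hv => hSmem i v hv ψ hψ'⟩
    by_contra hne
    have hij : ψ (u i) = ψ (u j) := hij
    have hsub : (V i \ T (u i)) ∪ (V j \ T (u j))
        ⊆ Finset.univ.filter fun v => ψ v = ψ (u i) := by
      intro v hv
      simp only [Finset.mem_filter, Finset.mem_univ, true_and]
      rcases Finset.mem_union.1 hv with hv | hv
      · exact hSmem i v hv ψ hψ'
      · rw [hij]
        exact hSmem j v hv ψ hψ'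
    have h1 := Finset.card_le_card hsub
    rw [Finset.card_union_of_disjoint (hdisj i j hne)] at h1
    have h1' : ((V i \ T (u i)).card : ℝ) + (V j \ T (u j)).card
        ≤ (Finset.univ.filter fun v => ψ v = ψ (u i)).card := by exact_mod_cast h1
    have h2 := (abs_le.1 (hbal ψ hψ' (ψ (u i)))).2
    have h3 := hScard i
    have h4 := hScard j
    have h5 : (n : ℝ) / r = 1 / r * n := by ring
    have h6 : ε * n ≤ α / 4 * n := by gcongr; linarith
    have h7 : 4 * α * n ≤ 1 / r * n := by gcongr
    have h8 : 0 < α * n := by positivity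
    linarith

lemma AdmitsCore.mono {α β : ℝ} (hαβ : α ≤ β) (h : AdmitsCore d r α G) :
    AdmitsCore d r β G := by
  obtain ⟨S, h1, h2, h3⟩ := h
  refine ⟨S, h1, fun i => lt_of_le_of_lt ?_ (h2 i), h3⟩
  gcongr

end Core

section Limit

variable {n r d : ℕ} {p δ : ℝ} {Φ : EdgeSetGraph n → Fin n → Fin r}

lemma prGnp_eq_expect (A : EdgeSetGraph n → Prop) :
    prGnp n p A = expect n p fun G => if A G then 1 else 0 := by
  unfold prGnp expect wt
  rw [Finset.sum_filter]
  exact Finset.sum_congr rfl fun G _ => by by_cases h : A G <;> simp [h]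

lemma prGnp_le_one (h0 : 0 ≤ p) (h1 : p ≤ 1) (A : EdgeSetGraph n → Prop) : prGnp n p A ≤ 1 := by
  rw [prGnp_eq_expect]
  exact (expect_mono h0 h1 (g := fun _ => 1) fun G => by split_ifs <;> norm_num).trans_eq
    (expect_const 1)

lemma expect_numSeparable_le_sq (hr : 2 ≤ r) (hδ : 0 < δ) (hp : p ≤ 1 - δ)
    (hnp : 1 ≤ n * p) (hΦ : ∀ G, cutSize (Φ G) G = maxCut n r G) {γ : ℝ} (hγ : 0 < γ)
    (hγn : 4 ≤ γ * n) :
    expect n p (fun G => numSeparable d (Φ G) G)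
      ≤ n ^ 2 * ((10 * r / δ + 160 * r / (δ ^ 2 * γ) + 20 / (δ ^ 2 * γ) + 10 * r / δ ^ 2
        + 1 / δ ^ 2) * ((d + 2) / √(n * p)) + γ / δ ^ 2) := by
  have hn : (0 : ℝ) < n := by
    rcases Nat.eq_zero_or_pos n with rfl | h
    · norm_num at hnp
    · exact_mod_cast h
  have h0 : 0 < p := pos_of_mul_pos_right (by linarith) hn.le
  have h1 : p ≤ 1 := by linarith
  have hn1 : (1 : ℝ) ≤ n := by nlinarith
  set s := √(n * p) with hs
  have hs1 : 1 ≤ s := Real.one_le_sqrt.2 hnp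
  have hs0 : 0 < s := by linarith
  have hss : s ^ 2 = n * p := Real.sq_sqrt (by linarith)
  have hM := expect_maxDev_le h0.le h1 hnp
  have hM' : expect n p (maxDev p) ≤ 10 * (n ^ 2 * p * (1 / s)) := by
    refine hM.trans (le_of_eq ?_)
    rw [← hs]
    field_simp
    rw [hss]
  have main := expect_numSeparable_le hr h0.le hδ hp hΦ d hγn
  obtain ⟨q, hq⟩ : ∃ q, q = 1 / s := ⟨_, rfl⟩
  rw [← hq] at hM'
  have hq0 : 0 < q := by rw [hq]; positivity
  have hnq : 1 / n ≤ q := by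
    rw [hq]
    apply one_div_le_one_div_of_le hs0
    nlinarith
  have e0 : (d + 2 : ℝ) / s = (d + 2) * q := by rw [hq]; ring
  rw [e0]
  have hc : 0 < p * (δ * (γ * n) / 8) * δ := by positivity
  refine le_of_mul_le_mul_left (main.trans ?_) hc
  have mono : (δ * (γ * n) / 8) * (r * expect n p (maxDev p))
        + 2 * n * (d + 2) * (r * expect n p (maxDev p))
        + p * (δ * (γ * n) / 8) * (n * (2 * expect n p (maxDev p) / (δ * (γ * n)))
          + (r * expect n p (maxDev p) + (γ * n + 1) * n) / δ)
      ≤ (δ * (γ * n) / 8) * (r * (10 * (n ^ 2 * p * q)))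
        + 2 * n * (d + 2) * (r * (10 * (n ^ 2 * p * q)))
        + p * (δ * (γ * n) / 8) * (n * (2 * (10 * (n ^ 2 * p * q)) / (δ * (γ * n)))
          + (r * (10 * (n ^ 2 * p * q)) + (γ * n + 1) * n) / δ) := by
    gcongr
  refine mono.trans ?_
  have e : (δ * (γ * n) / 8) * (r * (10 * (n ^ 2 * p * q)))
        + 2 * n * (d + 2) * (r * (10 * (n ^ 2 * p * q)))
        + p * (δ * (γ * n) / 8) * (n * (2 * (10 * (n ^ 2 * p * q)) / (δ * (γ * n)))
          + (r * (10 * (n ^ 2 * p * q)) + (γ * n + 1) * n) / δ)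
      = p * (δ * (γ * n) / 8) * δ * (n ^ 2 * (10 * r / δ * q
        + 160 * r / (δ ^ 2 * γ) * ((d + 2) * q) + 20 / (δ ^ 2 * γ) * (p * q)
        + 10 * r / δ ^ 2 * (p * q) + 1 / δ ^ 2 * (1 / n) + γ / δ ^ 2)) := by
    field_simp
    ring
  rw [e]
  have hd0 : (0 : ℝ) ≤ d := Nat.cast_nonneg _
  have hqd : q ≤ (d + 2) * q := by nlinarith
  have hpq : p * q ≤ (d + 2) * q := by nlinarith
  have hnq' := hnq.trans hqd
  obtain ⟨Y, hY⟩ : ∃ Y, Y = ((d : ℝ) + 2) * q := ⟨_, rfl⟩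
  rw [← hY] at hqd hpq hnq' ⊢
  refine mul_le_mul_of_nonneg_left (mul_le_mul_of_nonneg_left ?_ (by positivity)) hc.le
  calc _ ≤ 10 * r / δ * Y + 160 * r / (δ ^ 2 * γ) * Y + 20 / (δ ^ 2 * γ) * Y
        + 10 * r / δ ^ 2 * Y + 1 / δ ^ 2 * Y + γ / δ ^ 2 := by gcongr
    _ = _ := by ring

lemma one_sub_prGnp_le (hr : 2 ≤ r) (h0 : 0 < p) (h1 : p ≤ 1) (hn : 0 < n)
    (hΦ : ∀ G, cutSize (Φ G) G = maxCut n r G) {α β η : ℝ} (hβ0 : 0 < β) (hβα : β ≤ α)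
    (hβr : 4 * r * β ≤ 1) (hη0 : 0 < η) (hη1 : (2 * r + 2) * η ≤ (β / 4) ^ 2 / 2)
    (hη2 : 8 * r * η ≤ β) (hnβ : 2 ≤ (β / 4) ^ 2 * n) (hd : d ≤ η * n ^ 2 * p) :
    1 - prGnp n p (fun G => AdmitsCore d r α G)
      ≤ 1 / (η * n ^ 2) * expect n p (fun G => numSeparable d (Φ G) G)
        + 1 / (η * n ^ 2 * p) * expect n p (maxDev p) := by
  have hn' : (0 : ℝ) < n := by exact_mod_cast hn
  have e : 1 - prGnp n p (fun G => AdmitsCore d r α G)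
      = expect n p fun G => 1 - if AdmitsCore d r α G then 1 else 0 := by
    rw [prGnp_eq_expect, expect_sub, expect_const]
  rw [e, ← expect_const_mul, ← expect_const_mul, ← expect_add]
  refine expect_mono h0.le h1 fun G => ?_
  have hB : 0 ≤ numSeparable d (Φ G) G :=
    Finset.sum_nonneg fun _ _ => Finset.sum_nonneg fun _ _ => by split_ifs <;> norm_num
  have hM := maxDev_nonneg (p := p) G
  by_cases hA : AdmitsCore d r α G
  · rw [if_pos hA, sub_self]
    positivity
  rw [if_neg hA, sub_zero]
  by_cases hB' : numSeparable d (Φ G) G ≤ η * n ^ 2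
  · by_cases hM' : maxDev p G ≤ η * n ^ 2 * p
    · exact absurd (AdmitsCore.mono hβα (admitsCore_of_balanced hr hn hβr hβ0 (by linarith) hη2
        (hΦ G) hB' fun ψ hψ => abs_card_part_sub_le (by omega) h0 (by positivity) hη1 hnβ hM' hd
        hψ)) hA
    · have : 1 ≤ 1 / (η * n ^ 2 * p) * maxDev p G := by
        rw [one_div_mul_eq_div, le_div_iff₀ (by positivity)]
        linarith
      have : 0 ≤ 1 / (η * n ^ 2) * numSeparable d (Φ G) G := by positivity
      linarith
  · have : 1 ≤ 1 / (η * n ^ 2) * numSeparable d (Φ G) G := by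
      rw [one_div_mul_eq_div, le_div_iff₀ (by positivity)]
      linarith
    have : 0 ≤ 1 / (η * n ^ 2 * p) * maxDev p G := by positivity
    linarith

lemma exists_maxCut (hr : 0 < r) (n : ℕ) :
    ∃ Φ : EdgeSetGraph n → Fin n → Fin r, ∀ G, cutSize (Φ G) G = maxCut n r G := by
  have hF : (Finset.univ : Finset (Fin n → Fin r)).Nonempty :=
    ⟨fun _ => ⟨0, hr⟩, Finset.mem_univ _⟩
  choose Φ _ hΦ using fun G => exists_eq_familyCut hF G
  exact ⟨Φ, hΦ⟩

end Limit

/-- If `r ≥ 2`, `α > 0`, `δ ∈ (0,1)`, `np → ∞`, `p ≤ 1 - δ` and `d = o(√(np))`, then whp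
`G_{n,p}` admits a `(d,r,α)`-core. -/
theorem whp_admits_core
    (r : ℕ) (hr : 2 ≤ r) (α : ℝ) (hα : 0 < α) (δ : ℝ) (hδ : δ ∈ Set.Ioo (0 : ℝ) 1)
    (p : ℕ → ℝ) (hp0 : ∀ n, 0 ≤ p n) (hp1 : ∀ n, p n ≤ 1 - δ)
    (hnp : Tendsto (fun n : ℕ => (n : ℝ) * p n) atTop atTop)
    (d : ℕ → ℕ)
    (hd : Tendsto (fun n : ℕ => (d n : ℝ) / Real.sqrt ((n : ℝ) * p n)) atTop (nhds 0)) :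
    Tendsto (fun n : ℕ => prGnp n (p n) fun G => AdmitsCore (d n) r α G)
      atTop (nhds 1) := by
  obtain ⟨hδ0, hδ1⟩ := hδ
  have hr' : (2 : ℝ) ≤ r := by exact_mod_cast hr
  set β := min α (1 / (4 * r)) with hβ
  have hβ0 : 0 < β := lt_min hα (by positivity)
  have hβr : 4 * r * β ≤ 1 := by
    have h : β ≤ 1 / (4 * r) := min_le_right _ _
    rw [le_div_iff₀ (by positivity)] at h
    linarith
  set η := min ((β / 4) ^ 2 / 2 / (2 * r + 2)) (β / (8 * r)) with hη
  have hη0 : 0 < η := lt_min (by positivity) (by positivity)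
  have hη1 : (2 * r + 2) * η ≤ (β / 4) ^ 2 / 2 := by
    have h : η ≤ (β / 4) ^ 2 / 2 / (2 * r + 2) := min_le_left _ _
    rw [le_div_iff₀ (by positivity)] at h
    linarith
  have hη2 : 8 * r * η ≤ β := by
    have h : η ≤ β / (8 * r) := min_le_right _ _
    rw [le_div_iff₀ (by positivity)] at h
    linarith
  have hp1' : ∀ n, p n ≤ 1 := fun n => by linarith [hp1 n]
  refine tendsto_order.2 ⟨fun a ha => ?_, fun a ha => Eventually.of_forall fun n =>
    (prGnp_le_one (hp0 n) (hp1' n) _).trans_lt ha⟩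
  obtain ⟨γ, hγ⟩ : ∃ γ, γ = δ ^ 2 * η * ((1 - a) / 2) := ⟨_, rfl⟩
  have hγ0 : 0 < γ := by
    rw [hγ]
    have : 0 < 1 - a := by linarith
    positivity
  obtain ⟨C, hC⟩ : ∃ C, C = 10 * r / δ + 160 * r / (δ ^ 2 * γ) + 20 / (δ ^ 2 * γ)
    + 10 * r / δ ^ 2 + 1 / δ ^ 2 := ⟨_, rfl⟩
  have hs : Tendsto (fun n : ℕ => √((n : ℝ) * p n)) atTop atTop :=
    Real.tendsto_sqrt_atTop.comp hnp
  have hlim : Tendsto (fun n : ℕ => 1 / η * (C * ((d n : ℝ) / √((n : ℝ) * p n)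
      + 2 / √((n : ℝ) * p n)) + 10 * (1 / √((n : ℝ) * p n)))) atTop (nhds 0) := by
    have h1 := hs.const_div_atTop 2
    have h2 := hs.const_div_atTop 1
    have := (((hd.add h1).const_mul C).add (h2.const_mul 10)).const_mul (1 / η)
    simpa using this
  have hN : Tendsto (fun n : ℕ => (n : ℝ)) atTop atTop := tendsto_natCast_atTop_atTop
  filter_upwards [hlim.eventually (gt_mem_nhds (by linarith : 0 < (1 - a) / 2)),
    hnp.eventually_ge_atTop 1, hd.eventually (gt_mem_nhds one_pos),
    hN.eventually_ge_atTop (4 / γ), hN.eventually_ge_atTop (2 / (β / 4) ^ 2),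
    hN.eventually_ge_atTop (1 / η), eventually_gt_atTop 0]
    with n hsmall hnp1 hdn hnγ hnβ hnη hn
  have hn' : (0 : ℝ) < n := by exact_mod_cast hn
  have hp : 0 < p n := pos_of_mul_pos_right (by linarith) hn'.le
  rw [div_le_iff₀ (by positivity)] at hnγ hnβ hnη
  obtain ⟨s, hs⟩ : ∃ s, s = √((n : ℝ) * p n) := ⟨_, rfl⟩
  have hs1 : 1 ≤ s := by rw [hs]; exact Real.one_le_sqrt.2 hnp1
  have hs0 : 0 < s := by linarith
  have hss : s ^ 2 = n * p n := by rw [hs]; exact Real.sq_sqrt (by linarith)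
  have hd' : (d n : ℝ) ≤ η * n ^ 2 * p n := by
    rw [← hs, div_lt_one hs0] at hdn
    have e : η * n ^ 2 * p n = (n * η) * s ^ 2 := by rw [hss]; ring
    rw [e]
    nlinarith
  obtain ⟨Φ, hΦ⟩ := exists_maxCut (by omega : 0 < r) n
  have hB := expect_numSeparable_le_sq (d := d n) hr hδ0 (hp1 n) hnp1 hΦ hγ0 (by linarith)
  have hM := expect_maxDev_le (hp0 n) (hp1' n) hnp1
  have hpr := one_sub_prGnp_le hr hp (hp1' n) hn hΦ hβ0 (min_le_left _ _) hβr hη0 hη1 hη2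
    (by linarith) hd'
  rw [← hC, ← hs] at hB
  rw [← hs] at hM hsmall
  have h1 : 1 / (η * n ^ 2) * expect n (p n) (fun G => numSeparable (d n) (Φ G) G)
      ≤ 1 / η * (C * ((d n : ℝ) / s + 2 / s)) + (1 - a) / 2 := by
    refine (mul_le_mul_of_nonneg_left hB (by positivity)).trans (le_of_eq ?_)
    have e : γ / δ ^ 2 = η * ((1 - a) / 2) := by
      rw [hγ]
      field_simp
    rw [e]
    field_simp
  have h2 : 1 / (η * n ^ 2 * p n) * expect n (p n) (maxDev (p n)) ≤ 1 / η * (10 * (1 / s)) := by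
    refine (mul_le_mul_of_nonneg_left hM (by positivity)).trans (le_of_eq ?_)
    have e : η * n ^ 2 * p n = η * n * s ^ 2 := by rw [hss]; ring
    rw [e]
    field_simp
  linarith

end
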